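/- arXiv:1107.2272 — 3 statements merged into one kernel-verified Lean document; each statement's English description precedes it below -/
import Mathlib

section
/- Let n ≥ 5. For the path P_n on n vertices: if n is even then ξ^ac(P_n) = 8(H_{n-1} − H_{(n-2)/2}) − (4/(n−1) + 4/(n−2)), and if n is odd then ξ^ac(P_n) = 8(H_{n-1} − H_{(n-3)/2}) − (12/(n−1) + 4/(n−2)), where H_m = Σ_{i=1}^{m} 1/i. -/
open Finset SimpleGraph

/-- Degree of a vertex `u`: the number of neighbors of `u`. -/
noncomputable def deg {V : Type*} [Fintype V] (G : SimpleGraph V) (u : V) : ℕ :=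
  {v | G.Adj u v}.ncard

/-- `M(u)`: the product of degrees of all neighbors of `u`. -/
noncomputable def Mprod {V : Type*} [Fintype V] (G : SimpleGraph V) (u : V) : ℕ :=
  ∏ᶠ v ∈ {v | G.Adj u v}, deg G v

/-- Eccentricity of a vertex `u`: the maximum distance from `u` to any vertex. -/
noncomputable def ecc {V : Type*} [Fintype V] (G : SimpleGraph V) (u : V) : ℕ :=
  Finset.univ.sup fun v => G.dist u v

/-- Diameter of a graph: the maximum distance between two vertices. -/
noncomputable def gdiam {V : Type*} [Fintype V] (G : SimpleGraph V) : ℕ :=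
  Finset.univ.sup fun u => ecc G u

/-- The augmented eccentric connectivity index `ξ^{ac}(G) = ∑_u M(u)/ε(u)`. -/
noncomputable def xiAC {V : Type*} [Fintype V] (G : SimpleGraph V) : ℝ :=
  ∑ u : V, (Mprod G u : ℝ) / (ecc G u : ℝ)

/-- The `m`-th harmonic number `H_m = ∑_{i=1}^m 1/i`. -/
noncomputable def harm (m : ℕ) : ℝ := ∑ i ∈ Finset.range m, (1 : ℝ) / (i + 1)

theorem pathGraph_neighbors_first {n : ℕ} (u w : Fin n) (hu : u.val = 0) (hw : w.val = 1) :
    {v | (pathGraph n).Adj u v} = {w} := by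
  ext v
  simp only [Set.mem_ofPred_eq, pathGraph_adj, Set.mem_singleton_iff, Fin.ext_iff]
  omega

theorem pathGraph_neighbors_last {n : ℕ} (u w : Fin n) (hu : u.val + 1 = n)
    (hw : w.val + 1 = u.val) : {v | (pathGraph n).Adj u v} = {w} := by
  ext v
  simp only [Set.mem_ofPred_eq, pathGraph_adj, Set.mem_singleton_iff, Fin.ext_iff]
  omega

theorem pathGraph_neighbors_interior {n : ℕ} (u a b : Fin n) (ha : a.val + 1 = u.val)
    (hb : u.val + 1 = b.val) : {v | (pathGraph n).Adj u v} = {a, b} := by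
  ext v
  simp only [Set.mem_ofPred_eq, pathGraph_adj, Set.mem_insert_iff, Set.mem_singleton_iff,
    Fin.ext_iff]
  omega

theorem deg_pathGraph {n : ℕ} (hn : 2 ≤ n) (u : Fin n) :
    deg (pathGraph n) u = if u.val = 0 ∨ u.val + 1 = n then 1 else 2 := by
  have hu := u.isLt
  unfold deg
  split_ifs with h
  · rcases h with h | h
    · rw [pathGraph_neighbors_first u ⟨1, by omega⟩ h rfl, Set.ncard_singleton]
    · rw [pathGraph_neighbors_last u ⟨u.val - 1, by omega⟩ h (by simp only; omega),
        Set.ncard_singleton]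
  · rw [pathGraph_neighbors_interior u ⟨u.val - 1, by omega⟩ ⟨u.val + 1, by omega⟩
      (by simp only; omega) rfl, Set.ncard_pair]
    rw [Ne, Fin.ext_iff]
    simp only
    omega

theorem Mprod_pathGraph {n : ℕ} (hn : 5 ≤ n) (u : Fin n) :
    Mprod (pathGraph n) u = if u.val < 2 ∨ n < u.val + 3 then 2 else 4 := by
  have hu := u.isLt
  unfold Mprod
  by_cases h0 : u.val = 0
  · rw [pathGraph_neighbors_first u ⟨1, by omega⟩ h0 rfl, finprod_mem_singleton,
      deg_pathGraph (by omega), if_neg (by simp only; omega), if_pos (by omega)]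
  by_cases h1 : u.val + 1 = n
  · rw [pathGraph_neighbors_last u ⟨u.val - 1, by omega⟩ h1 (by simp only; omega),
      finprod_mem_singleton, deg_pathGraph (by omega), if_neg (by simp only; omega),
      if_pos (by omega)]
  rw [pathGraph_neighbors_interior u ⟨u.val - 1, by omega⟩ ⟨u.val + 1, by omega⟩
      (by simp only; omega) rfl, finprod_mem_pair (by rw [Ne, Fin.ext_iff]; simp only; omega),
      deg_pathGraph (by omega), deg_pathGraph (by omega)]
  simp only [Nat.add_eq_zero_iff, one_ne_zero, and_false, false_or]
  split_ifs <;> omega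

theorem pathGraph_val_le_add_length {n : ℕ} {u v : Fin n} (w : (pathGraph n).Walk u v) :
    u.val ≤ v.val + w.length ∧ v.val ≤ u.val + w.length := by
  induction w with
  | nil => simp
  | cons h _ ih =>
    rw [pathGraph_adj] at h
    rw [Walk.length_cons]
    omega

theorem pathGraph_dist_le_of_add {n : ℕ} (k : ℕ) (u v : Fin n) (h : u.val + k = v.val) :
    (pathGraph n).dist u v ≤ k := by
  induction k generalizing v with
  | zero =>
    obtain rfl : u = v := Fin.ext (by omega)
    simp
  | succ k ih =>
    have hv := v.isLt
    let w : Fin n := ⟨u.val + k, by omega⟩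
    have hadj : (pathGraph n).Adj w v := by
      rw [pathGraph_adj]
      exact Or.inl h
    have htri := (pathGraph_preconnected n u w).dist_triangle_left v
    rw [dist_eq_one_iff_adj.mpr hadj] at htri
    exact htri.trans (Nat.add_le_add_right (ih w rfl) 1)

theorem dist_pathGraph {n : ℕ} (u v : Fin n) :
    (pathGraph n).dist u v = (u.val - v.val) + (v.val - u.val) := by
  obtain ⟨w, hw⟩ := (pathGraph_preconnected n u v).exists_walk_length_eq_dist
  have hlower := pathGraph_val_le_add_length w
  rcases le_total u.val v.val with h | h
  · have := pathGraph_dist_le_of_add (v.val - u.val) u v (by omega)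
    omega
  · have := pathGraph_dist_le_of_add (u.val - v.val) v u (by omega)
    rw [dist_comm] at this
    omega

theorem ecc_pathGraph {n : ℕ} (u : Fin n) :
    ecc (pathGraph n) u = max u.val (n - 1 - u.val) := by
  have hu := u.isLt
  unfold ecc
  simp only [dist_pathGraph]
  apply le_antisymm
  · refine Finset.sup_le fun v _ => ?_
    have hv := v.isLt
    omega
  · apply max_le
    · refine le_trans ?_ (Finset.le_sup (Finset.mem_univ (⟨0, by omega⟩ : Fin n)))
      simp only
      omega
    · refine le_trans ?_ (Finset.le_sup (Finset.mem_univ (⟨n - 1, by omega⟩ : Fin n)))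
      simp only
      omega

/-- Only the two outermost vertices at each end of the path have neighbor product `2`
instead of `4`. -/
theorem xiAC_pathGraph_eq_sum_max {n : ℕ} (hn : 5 ≤ n) :
    xiAC (pathGraph n) = 4 * ∑ i ∈ range n, (1 : ℝ) / (max i (n - 1 - i) : ℕ)
      - (4 / ((n : ℝ) - 1) + 4 / ((n : ℝ) - 2)) := by
  unfold xiAC
  simp only [Mprod_pathGraph hn, ecc_pathGraph]
  rw [Fin.sum_univ_eq_sum_range
    (fun i => ((if i < 2 ∨ n < i + 3 then 2 else 4 : ℕ) : ℝ) / (max i (n - 1 - i) : ℕ)) n]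
  obtain ⟨k, rfl⟩ : ∃ k, n = k + 4 := ⟨n - 4, by omega⟩
  have hinner : ∀ i ∈ range k,
      ((if i + 1 + 1 < 2 ∨ k + 4 < i + 1 + 1 + 3 then 2 else 4 : ℕ) : ℝ) /
        (max (i + 1 + 1) (k + 4 - 1 - (i + 1 + 1)) : ℕ) =
      4 * (1 / (max (i + 1 + 1) (k + 4 - 1 - (i + 1 + 1)) : ℕ)) := by
    intro i hi
    rw [mem_range] at hi
    rw [if_neg (by omega)]
    push_cast
    ring
  rw [show k + 4 = (k + 1 + 1) + 1 + 1 from rfl]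
  simp only [sum_range_succ _ (k + 1 + 1 + 1), sum_range_succ _ (k + 1 + 1),
    sum_range_succ' _ (k + 1), sum_range_succ' _ k]
  rw [show k + 1 + 1 + 1 + 1 = k + 4 from rfl, sum_congr rfl hinner, ← mul_sum]
  rw [if_pos (by omega), if_pos (by omega), if_pos (by omega), if_pos (by omega),
    show max (0 + 1) (k + 4 - 1 - (0 + 1)) = k + 2 by omega,
    show max 0 (k + 4 - 1 - 0) = k + 3 by omega,
    show max (k + 1 + 1) (k + 4 - 1 - (k + 1 + 1)) = k + 2 by omega,
    show max (k + 1 + 1 + 1) (k + 4 - 1 - (k + 1 + 1 + 1)) = k + 3 by omega]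
  have h1 : ((k + 4 : ℕ) : ℝ) - 1 = k + 3 := by push_cast; ring
  have h2 : ((k + 4 : ℕ) : ℝ) - 2 = k + 2 := by push_cast; ring
  rw [h1, h2]
  push_cast
  ring

theorem harm_add_sub_harm (a b : ℕ) :
    harm (a + b) - harm a = ∑ j ∈ range b, (1 : ℝ) / (a + j + 1 : ℕ) := by
  simp [harm, sum_range_add]

theorem sum_one_div_max_even (m : ℕ) :
    ∑ i ∈ range (2 * (m + 1)), (1 : ℝ) / (max i (2 * (m + 1) - 1 - i) : ℕ) =
      2 * (harm (2 * m + 1) - harm m) := by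
  rw [show 2 * m + 1 = m + (m + 1) by ring, harm_add_sub_harm, two_mul (m + 1), sum_range_add,
    ← sum_range_reflect, two_mul]
  congr 1 <;> refine sum_congr rfl fun j hj => ?_ <;> rw [mem_range] at hj <;> congr 2 <;> omega

theorem sum_one_div_max_odd (m : ℕ) :
    ∑ i ∈ range (2 * (m + 1) + 1), (1 : ℝ) / (max i (2 * (m + 1) + 1 - 1 - i) : ℕ) =
      2 * (harm (2 * m + 2) - harm m) - 1 / (m + 1) := by
  rw [show 2 * m + 2 = m + (m + 2) by ring, harm_add_sub_harm,
    show 2 * (m + 1) + 1 = (m + 1) + (m + 2) by ring, sum_range_add, ← sum_range_reflect, two_mul,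
    add_sub_right_comm]
  congr 1
  · rw [sum_range_succ' _ (m + 1)]
    simp only [add_zero, Nat.cast_add, Nat.cast_one, add_sub_cancel_right]
    refine sum_congr rfl fun j hj => ?_
    rw [mem_range] at hj
    rw [show max (m + 1 - 1 - j) (m + 1 + (m + 2) - 1 - (m + 1 - 1 - j)) = m + (j + 1) + 1 by omega]
    push_cast
    rfl
  · refine sum_congr rfl fun j hj => ?_
    rw [mem_range] at hj
    congr 2
    omega

/-- For `n ≥ 5`, the value of the augmented eccentric connectivity index of the path `P_n`:
if `n` is even then `ξ^{ac}(P_n) = 8(H_{n-1} - H_{(n-2)/2}) - (4/(n-1) + 4/(n-2))`, and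
if `n` is odd then `ξ^{ac}(P_n) = 8(H_{n-1} - H_{(n-3)/2}) - (12/(n-1) + 4/(n-2))`. -/
theorem xiAC_pathGraph (n : ℕ) (hn : 5 ≤ n) :
    (Even n → xiAC (pathGraph n) =
      8 * (harm (n - 1) - harm ((n - 2) / 2)) - (4 / ((n : ℝ) - 1) + 4 / ((n : ℝ) - 2))) ∧
    (Odd n → xiAC (pathGraph n) =
      8 * (harm (n - 1) - harm ((n - 3) / 2)) - (12 / ((n : ℝ) - 1) + 4 / ((n : ℝ) - 2))) := by
  rw [xiAC_pathGraph_eq_sum_max hn]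
  constructor
  · rintro ⟨k, rfl⟩
    obtain ⟨m, rfl⟩ : ∃ m, k = m + 1 := ⟨k - 1, by omega⟩
    rw [← two_mul, sum_one_div_max_even, show 2 * (m + 1) - 1 = 2 * m + 1 by omega,
      show (2 * (m + 1) - 2) / 2 = m by omega]
    ring
  · rintro ⟨k, rfl⟩
    obtain ⟨m, rfl⟩ : ∃ m, k = m + 1 := ⟨k - 1, by omega⟩
    rw [sum_one_div_max_odd, show 2 * (m + 1) + 1 - 1 = 2 * m + 2 by omega,
      show (2 * (m + 1) + 1 - 3) / 2 = m by omega]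
    have hm : (m : ℝ) + 1 ≠ 0 := by positivity
    have h1 : ((2 * (m + 1) + 1 : ℕ) : ℝ) - 1 = 2 * (m + 1) := by push_cast; ring
    rw [h1]
    field_simp
    ring
end

section
/- Let n ≥ 6 be even. For the degree balanced tree TB_{n,n/2}, ξ^ac(TB_{n,n/2}) = 2^{n/2 − 2} + (n² + 3n − 6)/12. -/
open Finset SimpleGraph

/-- `T` is (isomorphic to) the degree balanced tree `TB_{n,k}`: a tree on `n` vertices of
diameter 4 whose central vertex has degree `k` and in which the degrees of any two
neighbors of the central vertex differ by at most one. -/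
def IsTB {V : Type*} [Fintype V] (T : SimpleGraph V) (n k : ℕ) : Prop :=
  T.IsTree ∧ Fintype.card V = n ∧ gdiam T = 4 ∧
  ∃ c : V, (∀ v, ecc T c ≤ ecc T v) ∧ deg T c = k ∧
    ∀ v w, T.Adj c v → T.Adj c w → deg T v ≤ deg T w + 1

/-- In a tree, geodesics leaving `m` through different neighbors concatenate to a geodesic. -/
theorem SimpleGraph.IsTree.dist_eq_add_of_ne {V : Type*} {G : SimpleGraph V} (hG : G.IsTree)
    {m x y a b : V} (hx : G.Adj m x) (hy : G.Adj m y) (hxy : x ≠ y)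
    (ha : G.dist m a = G.dist x a + 1) (hb : G.dist m b = G.dist y b + 1) :
    G.dist a b = G.dist m a + G.dist m b := by
  obtain ⟨p, hp⟩ := hG.connected.exists_walk_length_eq_dist x a
  obtain ⟨q, hq⟩ := hG.connected.exists_walk_length_eq_dist y b
  have hp' : (Walk.cons hx p).IsPath := Walk.isPath_of_length_eq_dist _ (by simp [hp, ha])
  have hq' : (Walk.cons hy q).IsPath := Walk.isPath_of_length_eq_dist _ (by simp [hq, hb])
  have key : ((Walk.cons hx p).reverse.append (Walk.cons hy q)).IsPath := by
    rw [hG.isAcyclic.isPath_iff_isChain, Walk.edges_append, List.isChain_append]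
    refine ⟨(hG.isAcyclic.isPath_iff_isChain _).1 hp'.reverse,
      (hG.isAcyclic.isPath_iff_isChain _).1 hq', ?_⟩
    intro e he f hf
    simp at he hf
    subst he hf
    rwa [ne_eq, Sym2.eq_swap, Sym2.congr_right]
  obtain ⟨r, hr, hrl⟩ := hG.connected.exists_path_of_dist a b
  have h2 := congrArg Walk.length (congrArg Subtype.val
    ((hG.isAcyclic.subsingleton_path a b).elim ⟨_, key⟩ ⟨r, hr⟩))
  simp at h2
  omega

/-- Every vertex other than the root has a neighbor closer to the root. -/
theorem SimpleGraph.Connected.exists_adj_dist_eq_add_one {V : Type*} {G : SimpleGraph V}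
    (hG : G.Connected) {u r : V} (h : u ≠ r) :
    ∃ x, G.Adj u x ∧ G.dist u r = G.dist x r + 1 := by
  obtain ⟨p, hp⟩ := hG.exists_walk_length_eq_dist u r
  cases p with
  | nil => exact absurd rfl h
  | @cons _ x _ hx p =>
    refine ⟨x, hx, le_antisymm ?_ ?_⟩
    · have := hG.dist_triangle (u := u) (v := x) (w := r)
      rw [dist_eq_one_iff_adj.2 hx] at this
      omega
    · rw [← hp, Walk.length_cons]
      have := dist_le p
      omega

theorem dist_le_ecc {V : Type*} [Fintype V] (G : SimpleGraph V) (u v : V) :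
    G.dist u v ≤ ecc G u :=
  Finset.le_sup (f := fun v => G.dist u v) (Finset.mem_univ v)

theorem ecc_eq_of_le_of_exists {V : Type*} [Fintype V] {G : SimpleGraph V} {u : V} {d : ℕ}
    (h : ∀ v, G.dist u v ≤ d) (h' : ∃ v, d ≤ G.dist u v) : ecc G u = d := by
  obtain ⟨v, hv⟩ := h'
  exact le_antisymm (Finset.sup_le fun v _ => h v) (hv.trans (dist_le_ecc G u v))

theorem deg_eq_degree {V : Type*} [Fintype V] (G : SimpleGraph V) [DecidableRel G.Adj] (u : V) :
    deg G u = G.degree u := by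
  rw [deg, ← card_neighborFinset_eq_degree, ← Set.ncard_coe_finset]
  congr 1
  ext
  simp

theorem Mprod_eq_prod {V : Type*} [Fintype V] (G : SimpleGraph V) [DecidableRel G.Adj] (u : V) :
    Mprod G u = ∏ v ∈ G.neighborFinset u, G.degree v := by
  rw [Mprod, ← finprod_mem_coe_finset]
  refine finprod_mem_congr (by ext; simp) fun v _ => deg_eq_degree G v

/-- A tree of diameter 4 has radius 2. -/
theorem ecc_eq_two_of_gdiam_eq_four {V : Type*} [Fintype V] {T : SimpleGraph V} (hT : T.IsTree)
    (hd : gdiam T = 4) {c : V} (hc : ∀ v, ecc T c ≤ ecc T v) : ecc T c = 2 := by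
  have : Nonempty V := ⟨c⟩
  obtain ⟨a, -, ha⟩ := Finset.exists_mem_eq_sup Finset.univ Finset.univ_nonempty (fun u => ecc T u)
  obtain ⟨b, -, hb⟩ := Finset.exists_mem_eq_sup Finset.univ Finset.univ_nonempty
    (fun v => T.dist a v)
  have hdist : ∀ u v, T.dist u v ≤ 4 := fun u v =>
    (dist_le_ecc T u v).trans (hd ▸ Finset.le_sup (f := fun u => ecc T u) (Finset.mem_univ u))
  have hab : T.dist a b = 4 := by
    rw [← hb, ← hd]
    exact ha.symm
  have hne {u v : V} (h : T.dist u v ≠ 0) : u ≠ v := fun e => h (by rw [e, dist_self])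
  obtain ⟨x, hax, hx⟩ := hT.connected.exists_adj_dist_eq_add_one (hne (u := a) (v := b) (by omega))
  obtain ⟨m, hxm, hm⟩ := hT.connected.exists_adj_dist_eq_add_one (hne (u := x) (v := b) (by omega))
  obtain ⟨y, hmy, hy⟩ := hT.connected.exists_adj_dist_eq_add_one (hne (u := m) (v := b) (by omega))
  have hxa : T.dist x a = 1 := dist_eq_one_iff_adj.2 hax.symm
  have hma : T.dist m a = 2 := by
    have h1 := hT.connected.dist_triangle (u := a) (v := m) (w := b)
    have h2 := hT.connected.dist_triangle (u := m) (v := x) (w := a)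
    have h3 : T.dist m x = 1 := dist_eq_one_iff_adj.2 hxm.symm
    rw [T.dist_comm (u := a) (v := m)] at h1
    omega
  have hxy : x ≠ y := by
    rintro rfl
    omega
  have hm2 : ecc T m ≤ 2 := by
    refine Finset.sup_le fun v _ => ?_
    by_contra! hv
    obtain ⟨z, hmz, hz⟩ := hT.connected.exists_adj_dist_eq_add_one
      (hne (u := m) (v := v) (by omega))
    by_cases hzx : x = z
    · have := hT.dist_eq_add_of_ne hmy hmz (hzx ▸ hxy.symm) hy hz
      have := hdist b v
      omega
    · have := hT.dist_eq_add_of_ne (a := a) hxm.symm hmz hzx (by omega) hz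
      have := hdist a v
      omega
  have h1 := hT.connected.dist_triangle (u := a) (v := c) (w := b)
  have h2 := dist_le_ecc T c a
  have h3 := dist_le_ecc T c b
  have h4 := hc m
  rw [T.dist_comm (u := a) (v := c)] at h1
  omega

/-- For even `n ≥ 6`, the degree balanced tree `TB_{n, n/2}` satisfies
`ξ^{ac}(TB_{n,n/2}) = 2^{n/2 - 2} + (n² + 3n - 6)/12`. -/
theorem xiAC_TB_half (n : ℕ) (hn : 6 ≤ n) (hev : Even n)
    {V : Type*} [Fintype V] (T : SimpleGraph V) (hTB : IsTB T n (n / 2)) :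
    xiAC T = (2 : ℝ) ^ (n / 2 - 2) + ((n : ℝ) ^ 2 + 3 * (n : ℝ) - 6) / 12 := by
  classical
  obtain ⟨hT, hcard, hdiam, c, hmin, hdegc, hbal⟩ := hTB
  have hecc := ecc_eq_two_of_gdiam_eq_four hT hdiam hmin
  obtain ⟨k, rfl⟩ := hev
  have hk2 : (k + k) / 2 = k := by omega
  rw [hk2] at hdegc ⊢
  simp only [deg_eq_degree] at hdegc hbal
  have hconn := hT.connected
  set N := T.neighborFinset c with hN
  have hNcard : #N = k := by rw [hN, card_neighborFinset_eq_degree, hdegc]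
  have memN (v : V) : v ∈ N ↔ T.Adj c v := by simp [hN]
  set L := Finset.univ.filter fun v => T.dist c v = 2 with hL
  have memL (v : V) : v ∈ L ↔ T.dist c v = 2 := by simp [hL]
  have hcN : c ∉ N := by simp [memN]
  have hcL : c ∉ L := by simp [memL]
  have hNL : Disjoint N L := by
    rw [Finset.disjoint_left]
    intro v hv hv'
    rw [memN, ← dist_eq_one_iff_adj] at hv
    rw [memL] at hv'
    omega
  have hle2 (v : V) : T.dist c v ≤ 2 := hecc ▸ dist_le_ecc T c v
  have huniv : (Finset.univ : Finset V) = insert c (N ∪ L) := by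
    ext v
    have h0 : T.dist c v = 0 ↔ c = v := hconn.dist_eq_zero_iff
    have h1 : T.dist c v = 1 ↔ T.Adj c v := dist_eq_one_iff_adj
    have h2 := hle2 v
    simp only [Finset.mem_univ, Finset.mem_insert, Finset.mem_union, memN, memL, true_iff,
      ← h1, eq_comm (a := v), ← h0]
    omega
  have hsum {M : Type} [AddCommMonoid M] (f : V → M) :
      ∑ v, f v = f c + (∑ v ∈ N, f v + ∑ v ∈ L, f v) := by
    rw [huniv, Finset.sum_insert (by simp [hcN, hcL]), Finset.sum_union hNL]
  have hLcard : #L + k + 1 = k + k := by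
    have := hsum (fun _ => (1 : ℕ))
    simp only [sum_const, smul_eq_mul, mul_one, card_univ, hcard, hNcard] at this
    omega
  -- every vertex at distance two from the center has exactly one neighbor
  have hpar (w : V) (hw : w ∈ L) : ∃ v ∈ N, T.neighborFinset w = {v} := by
    rw [memL] at hw
    have hwc : w ≠ c := by
      rintro rfl
      simp at hw
    obtain ⟨v, hwv, hv⟩ := hconn.exists_adj_dist_eq_add_one hwc
    rw [T.dist_comm, hw] at hv
    refine ⟨v, ?_, ?_⟩
    · rw [memN, ← dist_eq_one_iff_adj, T.dist_comm]
      omega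
    · ext u
      rw [mem_neighborFinset, Finset.mem_singleton]
      refine ⟨fun hu => ?_, fun h => h ▸ hwv⟩
      by_contra hne
      have h1 := hT.dist_eq_dist_add_one_of_adj c hu
      have h2 := hle2 u
      have h3 := hT.dist_eq_add_of_ne hu hwv hne (a := c) (b := c)
        (by rw [T.dist_comm, T.dist_comm (u := u)]; omega)
        (by rw [T.dist_comm]; omega)
      rw [dist_self, T.dist_comm (u := w)] at h3
      omega
  have hdegL (w : V) (hw : w ∈ L) : T.degree w = 1 := by
    obtain ⟨v, -, hv⟩ := hpar w hw
    rw [← card_neighborFinset_eq_degree, hv, Finset.card_singleton]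
  have hsumN : ∑ v ∈ N, T.degree v + 1 = k + k := by
    have h1 := hsum (fun v => T.degree v)
    have h2 := hT.card_edgeFinset
    rw [T.sum_degrees_eq_twice_card_edges, Finset.sum_congr rfl hdegL, hdegc] at h1
    simp only [sum_const, smul_eq_mul, mul_one] at h1
    omega
  have hdegpos (v : V) (hv : v ∈ N) : 1 ≤ T.degree v := by
    rw [← card_neighborFinset_eq_degree, Nat.one_le_iff_ne_zero, Finset.card_ne_zero]
    exact ⟨c, by rw [mem_neighborFinset]; exact ((memN v).1 hv).symm⟩
  have hdegle (v : V) (hv : v ∈ N) : T.degree v ≤ 2 := by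
    have : ∃ u ∈ N, T.degree u ≤ 1 := by
      by_contra! h
      have := Finset.card_nsmul_le_sum N (fun v => T.degree v) 2 fun u hu => h u hu
      rw [hNcard, smul_eq_mul] at this
      omega
    obtain ⟨u, hu, hu1⟩ := this
    have := hbal v u ((memN v).1 hv) ((memN u).1 hu)
    omega
  -- the product of the degrees of the neighbors of the center
  have hprod : ∏ v ∈ N, T.degree v = 2 ^ (k - 1) := by
    have h1 : ∑ v ∈ N, (T.degree v - 1) = k - 1 := by
      have : ∑ v ∈ N, T.degree v = ∑ v ∈ N, (T.degree v - 1) + #N := by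
        rw [Finset.card_eq_sum_ones, ← Finset.sum_add_distrib]
        exact Finset.sum_congr rfl fun v hv => by have := hdegpos v hv; omega
      omega
    rw [← h1, ← Finset.prod_pow_eq_pow_sum]
    refine Finset.prod_congr rfl fun v hv => ?_
    have h2 := hdegpos v hv
    have h3 := hdegle v hv
    interval_cases T.degree v <;> rfl
  -- every neighbor of the center misses some vertex at distance two
  have hfar (v : V) (hv : v ∈ N) : ∃ w ∈ L, ¬ T.Adj v w := by
    by_contra! h
    have hsub : insert c L ⊆ T.neighborFinset v := by
      intro u hu
      rw [mem_neighborFinset]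
      rcases Finset.mem_insert.1 hu with rfl | hu
      · exact ((memN v).1 hv).symm
      · exact h u hu
    have := Finset.card_le_card hsub
    rw [Finset.card_insert_of_notMem hcL, card_neighborFinset_eq_degree] at this
    have := hdegle v hv
    omega
  have hbranch (v : V) (hv : v ∈ N) (x : V) (hx : T.dist c x = T.dist v x + 1) :
      ∃ w, T.dist x w = T.dist c x + 2 := by
    obtain ⟨w, hw, hvw⟩ := hfar v hv
    obtain ⟨p, hp, hwp⟩ := hpar w hw
    have hpw : T.Adj p w := by
      rw [T.adj_comm, ← mem_neighborFinset, hwp, Finset.mem_singleton]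
    have hw2 := (memL w).1 hw
    refine ⟨w, ?_⟩
    rw [← hw2]
    refine hT.dist_eq_add_of_ne ((memN v).1 hv) ((memN p).1 hp) ?_ hx ?_
    · rintro rfl
      exact hvw hpw
    · rw [hw2, dist_eq_one_iff_adj.2 hpw]
  have hbound (x y : V) : T.dist x y ≤ T.dist c x + 2 := by
    have h1 := hconn.dist_triangle (u := x) (v := c) (w := y)
    have h2 := hle2 y
    rw [T.dist_comm (u := x) (v := c)] at h1
    omega
  have heccbranch (v : V) (hv : v ∈ N) (x : V) (hx : T.dist c x = T.dist v x + 1) :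
      ecc T x = T.dist c x + 2 := by
    obtain ⟨w, hw⟩ := hbranch v hv x hx
    exact ecc_eq_of_le_of_exists (hbound x) ⟨w, hw.ge⟩
  have htermN (v : V) (hv : v ∈ N) : (Mprod T v : ℝ) / (ecc T v : ℝ) = k / 3 := by
    have h1 : T.dist c v = 1 := dist_eq_one_iff_adj.2 ((memN v).1 hv)
    have h2 : ecc T v = 3 := by rw [heccbranch v hv v (by rw [h1, SimpleGraph.dist_self]), h1]
    have h3 : Mprod T v = k := by
      rw [Mprod_eq_prod, ← hdegc]
      refine Finset.prod_eq_single c (fun u hu huc => hdegL u ?_) fun h => ?_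
      · rw [mem_neighborFinset] at hu
        have h4 := hT.dist_eq_dist_add_one_of_adj c hu
        have h5 := hle2 u
        have h6 := hconn.pos_dist_of_ne (Ne.symm huc)
        rw [memL]
        omega
      · exact absurd (by rw [mem_neighborFinset]; exact ((memN v).1 hv).symm) h
    rw [h2, h3]
    norm_num
  have htermL (w : V) (hw : w ∈ L) : (Mprod T w : ℝ) / (ecc T w : ℝ) = 1 / 2 := by
    obtain ⟨v, hv, hwv⟩ := hpar w hw
    have hvw : T.Adj v w := by
      rw [T.adj_comm, ← mem_neighborFinset, hwv, Finset.mem_singleton]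
    have h1 := (memL w).1 hw
    have h2 : ecc T w = 4 := by
      rw [heccbranch v hv w (by rw [h1, dist_eq_one_iff_adj.2 hvw]), h1]
    have h3 : T.degree v = 2 := by
      refine le_antisymm (hdegle v hv) ?_
      have hsub : {c, w} ⊆ T.neighborFinset v := by
        intro u hu
        rw [mem_neighborFinset]
        rcases Finset.mem_insert.1 hu with rfl | hu
        · exact ((memN v).1 hv).symm
        · rwa [Finset.mem_singleton.1 hu]
      have hcw : c ≠ w := fun h => hcL (h ▸ hw)
      have := Finset.card_le_card hsub
      rwa [Finset.card_pair hcw, card_neighborFinset_eq_degree] at this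
    rw [Mprod_eq_prod, hwv, Finset.prod_singleton, h2, h3]
    norm_num
  rw [xiAC, hsum, Finset.sum_congr rfl htermN, Finset.sum_congr rfl htermL, hecc, Mprod_eq_prod,
    hprod]
  obtain ⟨j, rfl⟩ : ∃ j, k = j + 2 := ⟨k - 2, by omega⟩
  have hLc : #L = j + 1 := by omega
  rw [Finset.sum_const, Finset.sum_const, hNcard, hLc]
  simp only [nsmul_eq_mul, Nat.add_sub_cancel, show j + 2 - 1 = j + 1 by omega]
  push_cast
  ring
end

section
/- Let T ≠ P_n be a tree on n vertices with diameter D, and let P = v₀v₁…v_D be a diametric path in T chosen so that the first branching vertex along P (from v₀) is as far as possible from v₀. Let v_i be the first branching vertex on P. If D > 2, i = 1 and deg(v_{i+1}) > 2, set u = v_{i+1}; otherwise set u = v_i. Let w₁,…,w_k be any k neighbors of u not lying on P, where 1 ≤ k ≤ deg(u) − 2. Then the tree T′ obtained from T by deleting the edges uw₁,…,uw_k and adding the edges v₀w₁,…,v₀w_k satisfies ξ^ac(T) > ξ^ac(T′). -/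
open Finset SimpleGraph

namespace SimpleGraph

variable {V : Type*} {G : SimpleGraph V}

/-- A function that changes by at most one along each edge changes by at most the distance. -/
theorem Reachable.le_add_dist_of_forall_adj {φ : V → ℕ} (hφ : ∀ x y, G.Adj x y → φ x ≤ φ y + 1)
    {x y : V} (h : G.Reachable x y) : φ x ≤ φ y + G.dist x y := by
  obtain ⟨p, hp⟩ := h.exists_walk_length_eq_dist
  rw [← hp]
  clear hp h
  induction p with
  | nil => simp
  | cons h p ih =>
    have := hφ _ _ h
    rw [Walk.length_cons]
    omega

theorem Connected.exists_adj_dist_add_one_eq (hG : G.Connected) {m z : V} (hmz : m ≠ z) :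
    ∃ n, G.Adj m n ∧ G.dist z n + 1 = G.dist z m := by
  obtain ⟨p, hp⟩ := hG.exists_walk_length_eq_dist m z
  cases p with
  | nil => exact absurd rfl hmz
  | @cons _ n _ h p =>
    refine ⟨n, h, ?_⟩
    have h1 := dist_le p
    have h2 : G.dist m z ≤ G.dist m n + G.dist n z := hG.dist_triangle
    rw [dist_eq_one_iff_adj.2 h] at h2
    rw [Walk.length_cons] at hp
    rw [dist_comm (u := z) (v := n), dist_comm (u := z) (v := m)]
    omega

namespace IsTree

/-- In a tree, a vertex has at most one neighbor closer to a given vertex. -/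
theorem eq_of_adj_of_dist_add_one_eq (hG : G.IsTree) {m n₁ n₂ z : V} (h₁ : G.Adj m n₁)
    (h₂ : G.Adj m n₂) (hd₁ : G.dist z n₁ + 1 = G.dist z m) (hd₂ : G.dist z n₂ + 1 = G.dist z m) :
    n₁ = n₂ := by
  obtain ⟨q, hq, hql⟩ := hG.connected.exists_path_of_dist z m
  have key : ∀ n, G.Adj m n → G.dist z n + 1 = G.dist z m → n = q.penultimate := by
    intro n hn hd
    obtain ⟨p, hp, hpl⟩ := hG.connected.exists_path_of_dist z n
    refine hG.isAcyclic.eq_penultimate_of_adj_end hq hn ?_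
    by_contra hnq
    have hm := hG.isAcyclic.mem_support_of_ne_mem_support_of_adj_of_isPath hp hq hn.symm hnq
    have := congrArg Walk.length (hG.isAcyclic.path_concat hq hp hn hm)
    rw [Walk.length_concat] at this
    omega
  rw [key n₁ h₁ hd₁, key n₂ h₂ hd₂]

theorem dist_eq_add_of_adj (hG : G.IsTree) {a z : V} : ∀ {m n : V}, G.Adj m n →
    G.dist a n = G.dist a m + 1 → G.dist z n + 1 = G.dist z m →
    G.dist a z = G.dist a m + G.dist m z := by
  have key : ∀ (l : ℕ) (m n : V), G.dist z n = l → G.Adj m n →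
      G.dist a n = G.dist a m + 1 → G.dist z n + 1 = G.dist z m →
      G.dist a z = G.dist a m + G.dist m z := by
    intro l
    induction l with
    | zero =>
      intro m n hl hmn ha hz
      obtain rfl := (hG.connected.dist_eq_zero_iff).1 hl
      rw [dist_comm (u := m)]
      omega
    | succ l ih =>
      intro m n hl hmn ha hz
      have hnz : n ≠ z := by
        rintro rfl
        simp at hl
      obtain ⟨n', hn', hd'⟩ := hG.connected.exists_adj_dist_add_one_eq hnz
      have h1 : G.dist a n' = G.dist a n + 1 := by
        rcases hG.dist_eq_dist_add_one_of_adj a hn' with h | h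
        · have := hG.eq_of_adj_of_dist_add_one_eq hn' hmn.symm h.symm ha.symm
          subst this
          omega
        · exact h
      have := ih n n' (by omega) hn' h1 hd'
      rw [dist_comm (u := n)] at this
      rw [dist_comm (u := m)]
      omega
  exact fun {m n} => key _ m n rfl

/-- If `m` lies between `a` and `b` in a tree, then it lies between `a` and `z` or between
`b` and `z`. -/
theorem dist_eq_add_or_dist_eq_add (hG : G.IsTree) {a b m : V}
    (h : G.dist a b = G.dist a m + G.dist m b) (z : V) :
    G.dist a z = G.dist a m + G.dist m z ∨ G.dist b z = G.dist b m + G.dist m z := by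
  by_cases hmz : m = z
  · subst hmz
    simp
  obtain ⟨n, hn, hd⟩ := hG.connected.exists_adj_dist_add_one_eq hmz
  rcases hG.dist_eq_dist_add_one_of_adj a hn with ha | ha
  · rcases hG.dist_eq_dist_add_one_of_adj b hn with hb | hb
    · have : G.dist a b ≤ G.dist a n + G.dist n b := hG.connected.dist_triangle
      rw [dist_comm (u := n)] at this
      rw [dist_comm (u := m) (v := b)] at h
      omega
    · exact Or.inr (hG.dist_eq_add_of_adj hn hb hd)
  · exact Or.inl (hG.dist_eq_add_of_adj hn ha hd)

end IsTree

/-- The graph obtained from `G` by replacing the edges from `u` to vertices of `W` by edges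
from `v` to these vertices. -/
def transplant (G : SimpleGraph V) (u v : V) (W : Finset V) : SimpleGraph V :=
  fromEdgeSet ((G.edgeSet \ {e | ∃ x ∈ W, e = s(u, x)}) ∪ {e | ∃ x ∈ W, e = s(v, x)})

theorem transplant_adj {u v : V} {W : Finset V} (hv : v ∉ W) {x y : V} :
    (G.transplant u v W).Adj x y ↔
      (G.Adj x y ∧ ¬ (x = u ∧ y ∈ W) ∧ ¬ (y = u ∧ x ∈ W)) ∨
        (x = v ∧ y ∈ W) ∨ (y = v ∧ x ∈ W) := by
  simp only [transplant, fromEdgeSet_adj, Set.mem_union, Set.mem_sdiff, mem_edgeSet,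
    Set.mem_ofPred_eq, Sym2.eq_iff]
  constructor
  · rintro ⟨⟨h, h'⟩ | ⟨w, hw, ⟨rfl, rfl⟩ | ⟨rfl, rfl⟩⟩, hne⟩
    · left
      refine ⟨h, ?_, ?_⟩
      · rintro ⟨rfl, hy⟩
        exact h' ⟨y, hy, Or.inl ⟨rfl, rfl⟩⟩
      · rintro ⟨rfl, hx⟩
        exact h' ⟨x, hx, Or.inr ⟨rfl, rfl⟩⟩
    · exact Or.inr (Or.inl ⟨rfl, hw⟩)
    · exact Or.inr (Or.inr ⟨rfl, hw⟩)
  · rintro (⟨h, h1, h2⟩ | ⟨rfl, hy⟩ | ⟨rfl, hx⟩)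
    · refine ⟨Or.inl ⟨h, ?_⟩, h.ne⟩
      rintro ⟨w, hw, ⟨rfl, rfl⟩ | ⟨rfl, rfl⟩⟩
      · exact h1 ⟨rfl, hw⟩
      · exact h2 ⟨rfl, hw⟩
    · refine ⟨Or.inr ⟨y, hy, Or.inl ⟨rfl, rfl⟩⟩, ?_⟩
      rintro rfl
      exact hv hy
    · refine ⟨Or.inr ⟨x, hx, Or.inr ⟨rfl, rfl⟩⟩, ?_⟩
      rintro rfl
      exact hv hx

/-- The vertices whose path to `u` ends with an edge from `W` to `u`. -/
def branchSet (G : SimpleGraph V) (u : V) (W : Finset V) : Set V :=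
  {x | ∃ w ∈ W, G.dist u x = G.dist w x + 1}

theorem mem_branchSet_of_mem {u : V} {W : Finset V} (hW : ∀ w ∈ W, G.Adj u w) {w : V}
    (hw : w ∈ W) : w ∈ G.branchSet u W :=
  ⟨w, hw, by rw [dist_eq_one_iff_adj.2 (hW w hw), dist_self]⟩

theorem IsTree.eq_and_mem_of_adj_branchSet (hG : G.IsTree) {u : V} {W : Finset V}
    (hW : ∀ w ∈ W, G.Adj u w) {x y : V} (hxy : G.Adj x y) (hx : x ∈ G.branchSet u W)
    (hy : y ∉ G.branchSet u W) : y = u ∧ x ∈ W := by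
  obtain ⟨w, hw, hd⟩ := hx
  have h1 : G.dist w y = G.dist u y + 1 := by
    have h := hG.dist_eq_dist_add_one_of_adj y (hW w hw)
    rw [dist_comm (u := y) (v := u), dist_comm (u := y) (v := w)] at h
    rcases h with h | h
    · exact absurd ⟨w, hw, h⟩ hy
    · exact h
  have h2 := hG.dist_eq_dist_add_one_of_adj u hxy
  have h3 := hG.dist_eq_dist_add_one_of_adj w hxy
  have hyu : y = u := by
    by_contra hyu
    obtain ⟨n, hn, hnd⟩ := hG.connected.exists_adj_dist_add_one_eq hyu
    have h4 : G.dist w n ≤ G.dist w u + G.dist u n := hG.connected.dist_triangle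
    rw [dist_comm (u := w) (v := u), dist_eq_one_iff_adj.2 (hW w hw)] at h4
    have h5 := hG.dist_eq_dist_add_one_of_adj w hn
    have : n = x := hG.eq_of_adj_of_dist_add_one_eq (z := w) hn hxy.symm (by omega) (by omega)
    subst this
    omega
  subst hyu
  refine ⟨rfl, ?_⟩
  have h6 : G.dist w x = 0 := by
    have := dist_eq_one_iff_adj.2 hxy.symm
    omega
  rwa [(hG.connected.dist_eq_zero_iff).1 h6] at hw

theorem IsTree.connected_transplant (hG : G.IsTree) {u v : V} {W : Finset V}
    (hW : ∀ w ∈ W, G.Adj u w) (hv : v ∉ G.branchSet u W) :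
    (G.transplant u v W).Connected := by
  have hvW : v ∉ W := fun h => hv (mem_branchSet_of_mem hW h)
  have key : ∀ x, (G.transplant u v W).Reachable v x := by
    have hu : (G.transplant u v W).Reachable v u := by
      by_contra hcon
      have hstep : ∀ (n : ℕ) (x : V), G.dist u x = n → x ∉ G.branchSet u W →
          (G.transplant u v W).Reachable u x := by
        intro n
        induction n with
        | zero =>
          intro x hx _
          rw [(hG.connected.dist_eq_zero_iff).1 hx]
        | succ n ih =>
          intro x hx hxB
          have hxu : x ≠ u := by
            rintro rfl
            simp at hx
          obtain ⟨y, hy, hyd⟩ := hG.connected.exists_adj_dist_add_one_eq hxu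
          have hyB : y ∉ G.branchSet u W := by
            intro hyB
            exact hxu (hG.eq_and_mem_of_adj_branchSet hW hy.symm hyB hxB).1
          refine (ih y (by omega) hyB).trans (Adj.reachable ?_)
          rw [transplant_adj hvW]
          refine Or.inl ⟨hy.symm, ?_, ?_⟩
          · rintro ⟨-, h⟩
            exact hxB (mem_branchSet_of_mem hW h)
          · rintro ⟨rfl, h⟩
            exact hxu rfl
      exact hcon (hstep _ v rfl hv).symm
    intro x
    obtain ⟨p⟩ := hG.connected u x
    have : ∀ {a b : V} (q : G.Walk a b), (G.transplant u v W).Reachable v a →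
        (G.transplant u v W).Reachable v b := by
      intro a b q
      induction q with
      | nil => exact id
      | @cons a c b h q ih =>
        intro ha
        apply ih
        by_cases h1 : a = u ∧ c ∈ W
        · exact Adj.reachable ((transplant_adj hvW).2 (Or.inr (Or.inl ⟨rfl, h1.2⟩)))
        by_cases h2 : c = u ∧ a ∈ W
        · rw [h2.1]
          exact hu
        exact ha.trans (Adj.reachable ((transplant_adj hvW).2 (Or.inl ⟨h, h1, h2⟩)))
    exact this p hu
  exact (connected_iff _).2 ⟨fun x y => (key x).symm.trans (key y), ⟨v⟩⟩

open Classical in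
theorem IsTree.branch_dist_le_dist_transplant (hG : G.IsTree) {u v : V} {W : Finset V}
    (hW : ∀ w ∈ W, G.Adj u w) (hv : v ∉ G.branchSet u W) {t : V} (ht : t ∉ G.branchSet u W)
    (y : V) :
    (if y ∈ G.branchSet u W then G.dist u y + G.dist v t else G.dist y t) ≤
      (G.transplant u v W).dist y t := by
  have hvW : v ∉ W := fun h => hv (mem_branchSet_of_mem hW h)
  have hlip : ∀ a b c : V, G.Adj a b → G.dist a c ≤ G.dist b c + 1 ∧
      G.dist c a ≤ G.dist c b + 1 := by
    intro a b c hab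
    have := hG.dist_eq_dist_add_one_of_adj c hab
    rw [dist_comm (u := a), dist_comm (u := b)]
    omega
  have h := Reachable.le_add_dist_of_forall_adj (G := G.transplant u v W)
    (φ := fun y => if y ∈ G.branchSet u W then G.dist u y + G.dist v t else G.dist y t)
    (x := y) (y := t) ?_ (hG.connected_transplant hW hv y t)
  · simpa [ht] using h
  intro a b hab
  rw [transplant_adj hvW] at hab
  rcases hab with ⟨hab, h1, h2⟩ | ⟨rfl, hb⟩ | ⟨rfl, ha⟩
  · by_cases haB : a ∈ G.branchSet u W <;> by_cases hbB : b ∈ G.branchSet u W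
    · have := (hlip a b u hab).2
      simp only [haB, hbB, if_true]
      omega
    · exact absurd (hG.eq_and_mem_of_adj_branchSet hW hab haB hbB) h2
    · exact absurd (hG.eq_and_mem_of_adj_branchSet hW hab.symm hbB haB) h1
    · simp only [haB, hbB, if_false]
      exact (hlip a b t hab).1
  · simp only [hv, mem_branchSet_of_mem hW hb, if_true, if_false]
    omega
  · simp only [hv, mem_branchSet_of_mem hW ha, if_true, if_false,
      dist_eq_one_iff_adj.2 (hW a ha)]
    omega

open Classical in
theorem IsTree.dist_add_dist_le_of_mem_branchSet (hG : G.IsTree) {u v : V} {W : Finset V}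
    (hW : ∀ w ∈ W, G.Adj u w) (hu : u ∉ G.branchSet u W) (hv : v ∉ G.branchSet u W) {z : V}
    (hz : z ∈ G.branchSet u W) : G.dist v u + G.dist u z ≤ G.dist v z := by
  have hlip : ∀ a b c : V, G.Adj a b → G.dist c a ≤ G.dist c b + 1 := by
    intro a b c hab
    have := hG.dist_eq_dist_add_one_of_adj c hab
    omega
  have h := Reachable.le_add_dist_of_forall_adj (G := G)
    (φ := fun y => if y ∈ G.branchSet u W then G.dist v u + G.dist u y else G.dist v y)
    (x := z) (y := v) ?_ (hG.connected z v)
  · rw [dist_comm (u := z)] at h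
    simpa [hv, hz] using h
  intro a b hab
  by_cases haB : a ∈ G.branchSet u W <;> by_cases hbB : b ∈ G.branchSet u W
  · have := hlip a b u hab
    simp only [haB, hbB, if_true]
    omega
  · obtain ⟨rfl, haW⟩ := hG.eq_and_mem_of_adj_branchSet hW hab haB hbB
    simp only [haB, hu, if_true, if_false, dist_eq_one_iff_adj.2 (hW a haW)]
    omega
  · obtain ⟨rfl, hbW⟩ := hG.eq_and_mem_of_adj_branchSet hW hab.symm hbB haB
    simp only [hbB, hu, if_true, if_false, dist_eq_one_iff_adj.2 (hW b hbW)]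
    omega
  · simp only [haB, hbB, if_false]
    exact hlip a b v hab

theorem IsTree.dist_eq_length_of_isPath (hG : G.IsTree) {v z : V} {p : G.Walk v z}
    (hp : p.IsPath) : G.dist v z = p.length := by
  obtain ⟨q, hq, hql⟩ := hG.connected.exists_path_of_dist v z
  have := (hG.isAcyclic.subsingleton_path v z).elim ⟨p, hp⟩ ⟨q, hq⟩
  rw [← hql, Subtype.mk.inj this]

theorem IsTree.dist_start_getVert (hG : G.IsTree) {v z : V} {p : G.Walk v z} (hp : p.IsPath)
    {j : ℕ} (hj : j ≤ p.length) : G.dist v (p.getVert j) = j := by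
  have := hG.dist_eq_length_of_isPath (hp.take j)
  rwa [Walk.take_length, min_eq_left hj] at this

theorem IsTree.dist_end_getVert (hG : G.IsTree) {v z : V} {p : G.Walk v z} (hp : p.IsPath)
    {j : ℕ} : G.dist z (p.getVert j) = p.length - j := by
  have := hG.dist_eq_length_of_isPath (hp.drop j)
  rwa [Walk.drop_length, dist_comm] at this

theorem IsTree.getVert_ne_getVert (hG : G.IsTree) {v z : V} {p : G.Walk v z} (hp : p.IsPath)
    {j l : ℕ} (hj : j ≤ p.length) (hl : l ≤ p.length) (hjl : j ≠ l) :
    p.getVert j ≠ p.getVert l := by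
  intro h
  have h1 := hG.dist_start_getVert hp hj
  have h2 := hG.dist_start_getVert hp hl
  rw [h] at h1
  omega

theorem not_mem_branchSet_self {u : V} {W : Finset V} : u ∉ G.branchSet u W := by
  rintro ⟨w, -, h⟩
  simp at h

section Fintype

variable [Fintype V]

theorem dist_le_ecc (x y : V) : G.dist x y ≤ ecc G x :=
  Finset.le_sup (f := fun v => G.dist x v) (Finset.mem_univ y)

theorem ecc_le {x : V} {E : ℕ} (h : ∀ y, G.dist x y ≤ E) : ecc G x ≤ E :=
  Finset.sup_le fun y _ => h y

theorem dist_le_gdiam (x y : V) : G.dist x y ≤ gdiam G :=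
  (dist_le_ecc x y).trans (Finset.le_sup (f := fun v => ecc G v) (Finset.mem_univ x))

theorem IsTree.ecc_le_ecc_transplant (hG : G.IsTree) {u v z : V} {W : Finset V}
    (hW : ∀ w ∈ W, G.Adj u w) (hv : v ∉ G.branchSet u W) (hz : z ∉ G.branchSet u W)
    (hmax : ∀ x y, G.dist x y ≤ G.dist v z) (hu : G.dist v z = G.dist v u + G.dist u z) (x : V) :
    ecc G x ≤ ecc (G.transplant u v W) x := by
  have hz' := hG.branch_dist_le_dist_transplant hW hv hz x
  have hez := dist_le_ecc (G := G.transplant u v W) x z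
  by_cases hx : x ∈ G.branchSet u W
  · rw [if_pos hx] at hz'
    refine ecc_le fun y => ?_
    have := hmax x y
    omega
  rw [if_neg hx] at hz'
  refine ecc_le fun y => ?_
  by_cases hy : y ∈ G.branchSet u W
  · have h1 := hG.branch_dist_le_dist_transplant hW hv hx y
    rw [if_pos hy, dist_comm (G := G.transplant u v W)] at h1
    have h2 := dist_le_ecc (G := G.transplant u v W) x y
    have h3 : G.dist x y ≤ G.dist x u + G.dist u y := hG.connected.dist_triangle
    rcases hG.dist_eq_add_or_dist_eq_add hu x with h | h
    · rw [dist_comm (u := x) (v := u)] at h3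
      omega
    · have h4 := hG.dist_add_dist_le_of_mem_branchSet hW not_mem_branchSet_self hv hy
      have h5 := hmax v y
      rw [dist_comm (u := z) (v := x), dist_comm (u := z) (v := u), dist_comm (u := u) (v := x)]
        at h
      omega
  · have h1 := hG.branch_dist_le_dist_transplant hW hv hy x
    rw [if_neg hx] at h1
    exact h1.trans (dist_le_ecc x y)

/-- The finset of neighbors of a vertex. -/
noncomputable def nbrs (G : SimpleGraph V) (x : V) : Finset V := by
  classical exact Finset.univ.filter (G.Adj x)

@[simp]
theorem mem_nbrs {x y : V} : y ∈ G.nbrs x ↔ G.Adj x y := by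
  simp [nbrs]

theorem deg_eq_card_nbrs (x : V) : deg G x = (G.nbrs x).card := by
  rw [deg, ← Set.ncard_coe_finset]
  congr 1
  ext y
  simp

theorem Mprod_eq_prod_nbrs (x : V) : Mprod G x = ∏ y ∈ G.nbrs x, deg G y := by
  rw [Mprod, ← finprod_mem_coe_finset]
  congr! with y
  ext y
  simp

theorem one_le_deg_of_adj {x y : V} (h : G.Adj x y) : 1 ≤ deg G x := by
  rw [deg_eq_card_nbrs]
  exact Finset.card_pos.2 ⟨y, by simpa using h⟩

theorem one_le_prod_deg {x : V} {s : Finset V} (hs : ∀ y ∈ s, G.Adj x y) :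
    1 ≤ ∏ y ∈ s, deg G y :=
  Finset.one_le_prod' fun y hy => one_le_deg_of_adj (hs y hy).symm

theorem deg_le_prod_deg {x y : V} {s : Finset V} (hs : ∀ y ∈ s, G.Adj x y) (hy : y ∈ s) :
    deg G y ≤ ∏ z ∈ s, deg G z :=
  Finset.single_le_prod' (fun z hz => one_le_deg_of_adj (hs z hz).symm) hy

open Classical in
theorem Mprod_eq_mul_prod_erase {x y : V} (h : G.Adj x y) :
    Mprod G x = deg G y * ∏ z ∈ (G.nbrs x).erase y, deg G z := by
  rw [Mprod_eq_prod_nbrs, Finset.mul_prod_erase _ _ (by simpa using h)]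

section Transplant

variable {u v : V} {W : Finset V}

open Classical in
theorem nbrs_transplant_left (hW : ∀ w ∈ W, G.Adj u w) (hv : v ∉ W) (huv : u ≠ v) :
    (G.transplant u v W).nbrs u = G.nbrs u \ W := by
  ext y
  have hu : u ∉ W := fun h => (hW u h).ne rfl
  simp [transplant_adj hv, hu, huv]

open Classical in
theorem nbrs_transplant_right (hv : v ∉ W) (huv : u ≠ v) :
    (G.transplant u v W).nbrs v = G.nbrs v ∪ W := by
  ext y
  simp only [mem_nbrs, transplant_adj hv, hv, Finset.mem_union]
  simp [huv.symm]

open Classical in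
theorem nbrs_transplant_of_mem (hW : ∀ w ∈ W, G.Adj u w) (hv : v ∉ W) {x : V} (hx : x ∈ W) :
    (G.transplant u v W).nbrs x = insert v ((G.nbrs x).erase u) := by
  ext y
  have hxu : x ≠ u := (hW x hx).ne'
  have hxv : x ≠ v := by
    rintro rfl
    exact hv hx
  simp only [mem_nbrs, transplant_adj hv, Finset.mem_insert, Finset.mem_erase]
  tauto

theorem nbrs_transplant_of_ne (hv : v ∉ W) {x : V} (hx : x ∉ W) (hxu : x ≠ u) (hxv : x ≠ v) :
    (G.transplant u v W).nbrs x = G.nbrs x := by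
  ext y
  simp only [mem_nbrs, transplant_adj hv]
  tauto

theorem deg_transplant_left (hW : ∀ w ∈ W, G.Adj u w) (hv : v ∉ W) (huv : u ≠ v) :
    deg (G.transplant u v W) u + W.card = deg G u := by
  classical
  rw [deg_eq_card_nbrs, deg_eq_card_nbrs, nbrs_transplant_left hW hv huv,
    Finset.card_sdiff_add_card_eq_card]
  intro w hw
  simpa using hW w hw

theorem deg_transplant_right (hv : v ∉ W) (huv : u ≠ v) (hvW : ∀ w ∈ W, ¬ G.Adj v w) :
    deg (G.transplant u v W) v = deg G v + W.card := by
  classical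
  rw [deg_eq_card_nbrs, deg_eq_card_nbrs, nbrs_transplant_right hv huv,
    Finset.card_union_of_disjoint]
  rw [Finset.disjoint_left]
  intro w hw hwW
  exact hvW w hwW (by simpa using hw)

theorem deg_transplant_of_ne (hW : ∀ w ∈ W, G.Adj u w) (hv : v ∉ W)
    (hvW : ∀ w ∈ W, ¬ G.Adj v w) {x : V} (hxu : x ≠ u) (hxv : x ≠ v) :
    deg (G.transplant u v W) x = deg G x := by
  classical
  rw [deg_eq_card_nbrs, deg_eq_card_nbrs]
  by_cases hx : x ∈ W
  · rw [nbrs_transplant_of_mem hW hv hx, Finset.card_insert_of_notMem, Finset.card_erase_add_one]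
    · simpa using (hW x hx).symm
    · intro h
      exact hvW x hx (by simpa using (Finset.mem_of_mem_erase h : v ∈ G.nbrs x) |> fun h =>
        (mem_nbrs.1 h).symm)
  · rw [nbrs_transplant_of_ne hv hx hxu hxv]

open Classical in
theorem Mprod_transplant_of_mem (hW : ∀ w ∈ W, G.Adj u w) (hv : v ∉ W) (huv : u ≠ v)
    (hvW : ∀ w ∈ W, ¬ G.Adj v w) {x : V} (hx : x ∈ W) :
    Mprod (G.transplant u v W) x =
      (deg G v + W.card) * ∏ y ∈ (G.nbrs x).erase u, deg G y := by
  have hnot : ∀ y ∈ (G.nbrs x).erase u, y ≠ v := by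
    rintro y hy rfl
    exact hvW x hx (mem_nbrs.1 (Finset.mem_of_mem_erase hy)).symm
  rw [Mprod_eq_prod_nbrs, nbrs_transplant_of_mem hW hv hx,
    Finset.prod_insert (fun h => hnot v h rfl), deg_transplant_right hv huv hvW]
  congr 1
  exact Finset.prod_congr rfl fun y hy =>
    deg_transplant_of_ne hW hv hvW (Finset.ne_of_mem_erase hy) (hnot y hy)

open Classical in
theorem Mprod_transplant_of_adj (hW : ∀ w ∈ W, G.Adj u w) (hv : v ∉ W)
    (hvW : ∀ w ∈ W, ¬ G.Adj v w) {x : V} (hx : x ∉ W) (hxu : G.Adj x u) (hxv : x ≠ v)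
    (hxv' : ¬ G.Adj x v) :
    Mprod (G.transplant u v W) x =
      deg (G.transplant u v W) u * ∏ y ∈ (G.nbrs x).erase u, deg G y := by
  rw [Mprod_eq_prod_nbrs, nbrs_transplant_of_ne hv hx hxu.ne hxv,
    ← Finset.mul_prod_erase _ _ (mem_nbrs.2 hxu)]
  congr 1
  refine Finset.prod_congr rfl fun y hy =>
    deg_transplant_of_ne hW hv hvW (Finset.ne_of_mem_erase hy) ?_
  rintro rfl
  exact hxv' (mem_nbrs.1 (Finset.mem_of_mem_erase hy))

theorem Mprod_transplant_of_not_adj (hW : ∀ w ∈ W, G.Adj u w) (hv : v ∉ W)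
    (hvW : ∀ w ∈ W, ¬ G.Adj v w) {x : V} (hx : x ≠ u) (hxu : ¬ G.Adj x u) (hxv : x ≠ v)
    (hxv' : ¬ G.Adj x v) : Mprod (G.transplant u v W) x = Mprod G x := by
  have hxW : x ∉ W := fun h => hxu (hW x h).symm
  rw [Mprod_eq_prod_nbrs, Mprod_eq_prod_nbrs, nbrs_transplant_of_ne hv hxW hx hxv]
  refine Finset.prod_congr rfl fun y hy => deg_transplant_of_ne hW hv hvW ?_ ?_
  · rintro rfl
    exact hxu (mem_nbrs.1 hy)
  · rintro rfl
    exact hxv' (mem_nbrs.1 hy)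

end Transplant

/-- The contribution of a vertex to the difference of the indices of `G` and `H`. -/
noncomputable def xiACDiff (G H : SimpleGraph V) (x : V) : ℝ :=
  (Mprod G x : ℝ) / (ecc G x : ℝ) - (Mprod H x : ℝ) / (ecc H x : ℝ)

theorem xiAC_lt_of_sum_pos {H : SimpleGraph V} (h : 0 < ∑ x, xiACDiff G H x) :
    xiAC H < xiAC G := by
  simp only [xiACDiff, Finset.sum_sub_distrib] at h
  simpa [xiAC] using h

theorem div_le_xiACDiff {H : SimpleGraph V} {x : V} {m E : ℕ} (hpos : 0 < ecc G x)
    (hE : ecc G x ≤ E) (hecc : ecc G x ≤ ecc H x) (hM : Mprod H x + m ≤ Mprod G x) :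
    (m / E : ℝ) ≤ xiACDiff G H x := by
  have h0 : (0 : ℝ) < ecc G x := by exact_mod_cast hpos
  have h1 : (Mprod H x : ℝ) / ecc H x ≤ Mprod H x / ecc G x := by gcongr
  have h2 : (m / E : ℝ) ≤ m / ecc G x := by gcongr
  have h3 : ((Mprod H x : ℝ) + m) / ecc G x ≤ Mprod G x / ecc G x := by
    gcongr
    exact_mod_cast hM
  rw [add_div] at h3
  rw [xiACDiff]
  linarith

theorem neg_div_le_xiACDiff {H : SimpleGraph V} {x : V} {m E : ℕ} (hpos : 0 < E)
    (hE : E ≤ ecc G x) (hecc : ecc G x ≤ ecc H x) (hM : Mprod H x ≤ Mprod G x + m) :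
    -(m / E : ℝ) ≤ xiACDiff G H x := by
  have hE0 : (0 : ℝ) < E := by exact_mod_cast hpos
  have h0 : (0 : ℝ) < ecc G x := by exact_mod_cast hpos.trans_le hE
  have h1 : (Mprod H x : ℝ) / ecc H x ≤ Mprod H x / ecc G x := by gcongr
  have h2 : (m : ℝ) / ecc G x ≤ m / E := by gcongr
  have h3 : (Mprod H x : ℝ) / ecc G x ≤ (Mprod G x + m) / ecc G x := by
    gcongr
    exact_mod_cast hM
  rw [add_div] at h3
  rw [xiACDiff]
  linarith

/-- The vertex `v` is a leaf with neighbor `v₁`, all neighbors of `v₁` except `v₂` are leaves,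
`W` is a set of neighbors of `u`, and moving the edges from `u` to `W` to `v` does not decrease
eccentricities. The diameter of the graph is `E + 1`. -/
structure IsTransplantConfig (G : SimpleGraph V) (u v v₁ v₂ : V) (W : Finset V) (b E : ℕ) :
    Prop where
  adj_of_mem : ∀ w ∈ W, G.Adj u w
  notMem : v ∉ W
  ne : u ≠ v
  not_adj_of_mem : ∀ w ∈ W, ¬ G.Adj v w
  deg_eq : deg G u = W.card + 1 + b
  one_le : 1 ≤ b
  one_le_card : 1 ≤ W.card
  ecc_le_ecc : ∀ x, ecc G x ≤ ecc (G.transplant u v W) x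
  ecc_pos : ∀ x, 0 < ecc G x
  ecc_le : ∀ x, ecc G x ≤ E + 1
  ecc_le_of_two_le_deg : ∀ x, 2 ≤ deg G x → ecc G x ≤ E
  le_ecc_leaf : E + 1 ≤ ecc G v
  le_ecc_nbr : E ≤ ecc G v₁
  pos : 1 ≤ E
  adj_iff : ∀ y, G.Adj v y ↔ y = v₁
  adj_next : G.Adj v₁ v₂
  next_ne : v₂ ≠ v
  deg_eq_one : ∀ y, G.Adj v₁ y → y ≠ v₂ → deg G y = 1
  next_notMem : v₂ ∉ W

namespace IsTransplantConfig

variable {u v v₁ v₂ : V} {W : Finset V} {b E : ℕ}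

theorem nbrs_leaf (h : G.IsTransplantConfig u v v₁ v₂ W b E) : G.nbrs v = {v₁} := by
  ext y
  simp [h.adj_iff]

theorem deg_leaf (h : G.IsTransplantConfig u v v₁ v₂ W b E) : deg G v = 1 := by
  rw [deg_eq_card_nbrs, h.nbrs_leaf, Finset.card_singleton]

theorem adj_leaf (h : G.IsTransplantConfig u v v₁ v₂ W b E) : G.Adj v v₁ :=
  (h.adj_iff v₁).2 rfl

theorem nbr_notMem (h : G.IsTransplantConfig u v v₁ v₂ W b E) : v₁ ∉ W :=
  fun hm => h.not_adj_of_mem _ hm h.adj_leaf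

theorem deg_transplant (h : G.IsTransplantConfig u v v₁ v₂ W b E) :
    deg (G.transplant u v W) u = b + 1 := by
  have := deg_transplant_left h.adj_of_mem h.notMem h.ne
  have := h.deg_eq
  omega

theorem deg_transplant_leaf (h : G.IsTransplantConfig u v v₁ v₂ W b E) :
    deg (G.transplant u v W) v = W.card + 1 := by
  rw [deg_transplant_right h.notMem h.ne h.not_adj_of_mem, h.deg_leaf, add_comm]

theorem not_adj_of_ne (h : G.IsTransplantConfig u v v₁ v₂ W b E) {x : V} (hx : x ≠ v₁) :
    ¬ G.Adj x v :=
  fun hadj => hx ((h.adj_iff x).1 hadj.symm)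

theorem le_diff_of_mem (h : G.IsTransplantConfig u v v₁ v₂ W b E) {x : V} (hx : x ∈ W) :
    (b / ((E + 1 : ℕ) : ℝ)) ≤ xiACDiff G (G.transplant u v W) x := by
  classical
  refine div_le_xiACDiff (h.ecc_pos x) (h.ecc_le x) (h.ecc_le_ecc x) ?_
  rw [Mprod_transplant_of_mem h.adj_of_mem h.notMem h.ne h.not_adj_of_mem hx, h.deg_leaf,
    Mprod_eq_mul_prod_erase (h.adj_of_mem x hx).symm, h.deg_eq]
  have : 1 ≤ ∏ y ∈ (G.nbrs x).erase u, deg G y :=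
    one_le_prod_deg (x := x) fun y hy => mem_nbrs.1 (Finset.mem_of_mem_erase hy)
  nlinarith

open Classical in
theorem le_diff_of_adj (h : G.IsTransplantConfig u v v₁ v₂ W b E) {x : V} (hx : x ∉ W)
    (hux : G.Adj u x) (hxv : x ≠ v) (hxv₁ : x ≠ v₁) {m F : ℕ} (hF : ecc G x ≤ F)
    (hm : m ≤ ∏ y ∈ (G.nbrs x).erase u, deg G y) :
    (((W.card * m : ℕ) : ℝ) / F) ≤ xiACDiff G (G.transplant u v W) x := by
  refine div_le_xiACDiff (h.ecc_pos x) hF (h.ecc_le_ecc x) ?_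
  rw [Mprod_transplant_of_adj h.adj_of_mem h.notMem h.not_adj_of_mem hx hux.symm hxv
    (h.not_adj_of_ne hxv₁), Mprod_eq_mul_prod_erase hux.symm, h.deg_eq, h.deg_transplant]
  nlinarith [Nat.mul_le_mul_left W.card hm]

theorem diff_nonneg (h : G.IsTransplantConfig u v v₁ v₂ W b E) {x : V} (hxu : x ≠ u)
    (hxv : x ≠ v) (hxv₁ : x ≠ v₁) : 0 ≤ xiACDiff G (G.transplant u v W) x := by
  classical
  by_cases hx : x ∈ W
  · exact le_trans (by positivity) (h.le_diff_of_mem hx)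
  by_cases hux : G.Adj u x
  · exact le_trans (by positivity) (h.le_diff_of_adj hx hux hxv hxv₁ (h.ecc_le x) (Nat.zero_le _))
  have := div_le_xiACDiff (H := G.transplant u v W) (m := 0) (h.ecc_pos x) (h.ecc_le x)
    (h.ecc_le_ecc x) (Mprod_transplant_of_not_adj h.adj_of_mem h.notMem h.not_adj_of_mem hxu
      (fun hh => hux hh.symm) hxv (h.not_adj_of_ne hxv₁)).le
  simpa using this

theorem Mprod_leaf (h : G.IsTransplantConfig u v v₁ v₂ W b E) : Mprod G v = deg G v₁ := by
  rw [Mprod_eq_prod_nbrs, h.nbrs_leaf, Finset.prod_singleton]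

theorem Mprod_transplant_leaf (h : G.IsTransplantConfig u v v₁ v₂ W b E) :
    Mprod (G.transplant u v W) v = deg (G.transplant u v W) v₁ * ∏ w ∈ W, deg G w := by
  classical
  rw [Mprod_eq_prod_nbrs, nbrs_transplant_right h.notMem h.ne, h.nbrs_leaf,
    Finset.prod_union (by simpa using h.nbr_notMem), Finset.prod_singleton]
  congr 1
  refine Finset.prod_congr rfl fun y hy => deg_transplant_of_ne h.adj_of_mem h.notMem
    h.not_adj_of_mem (h.adj_of_mem y hy).ne' ?_
  rintro rfl
  exact h.notMem hy

open Classical in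
theorem Mprod_eq_prod_sdiff_mul (h : G.IsTransplantConfig u v v₁ v₂ W b E) :
    Mprod G u = (∏ y ∈ G.nbrs u \ W, deg G y) * ∏ w ∈ W, deg G w := by
  rw [Mprod_eq_prod_nbrs, Finset.prod_sdiff]
  intro w hw
  simpa using h.adj_of_mem w hw

open Classical in
theorem Mprod_transplant_eq (h : G.IsTransplantConfig u v v₁ v₂ W b E) (hu : u ≠ v₁) :
    Mprod (G.transplant u v W) u = ∏ y ∈ G.nbrs u \ W, deg G y := by
  rw [Mprod_eq_prod_nbrs, nbrs_transplant_left h.adj_of_mem h.notMem h.ne]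
  refine Finset.prod_congr rfl fun y hy => ?_
  have hy' : G.Adj u y := mem_nbrs.1 (Finset.mem_sdiff.1 hy).1
  refine deg_transplant_of_ne h.adj_of_mem h.notMem h.not_adj_of_mem hy'.ne' ?_
  rintro rfl
  exact hu ((h.adj_iff u).1 hy'.symm)

theorem deg_transplant_nbr (h : G.IsTransplantConfig u v v₁ v₂ W b E) (hu : u ≠ v₁) :
    deg (G.transplant u v W) v₁ = deg G v₁ :=
  deg_transplant_of_ne h.adj_of_mem h.notMem h.not_adj_of_mem hu.symm h.adj_leaf.ne'

theorem neg_le_diff_leaf (h : G.IsTransplantConfig u v v₁ v₂ W b E) (hu : u ≠ v₁) :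
    -(((deg G v₁ * (∏ w ∈ W, deg G w - 1) : ℕ) : ℝ) / ((E + 1 : ℕ) : ℝ)) ≤
      xiACDiff G (G.transplant u v W) v := by
  refine neg_div_le_xiACDiff (Nat.succ_pos _) h.le_ecc_leaf (h.ecc_le_ecc v) ?_
  rw [h.Mprod_transplant_leaf, h.Mprod_leaf, h.deg_transplant_nbr hu]
  have := one_le_prod_deg h.adj_of_mem
  obtain ⟨P, hP⟩ := Nat.exists_eq_add_of_le this
  rw [hP, Nat.add_sub_cancel_left]
  linarith

theorem le_diff_center (h : G.IsTransplantConfig u v v₁ v₂ W b E) (hu : u ≠ v₁) {z : V}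
    (hz : G.Adj u z) (hzW : z ∉ W) (hdeg : deg G v₁ ≤ deg G z) :
    (((deg G v₁ * (∏ w ∈ W, deg G w - 1) : ℕ) : ℝ) / ((E + 1 : ℕ) : ℝ)) ≤
      xiACDiff G (G.transplant u v W) u := by
  classical
  refine div_le_xiACDiff (h.ecc_pos u) (h.ecc_le u) (h.ecc_le_ecc u) ?_
  rw [h.Mprod_transplant_eq hu, h.Mprod_eq_prod_sdiff_mul]
  have h1 := one_le_prod_deg h.adj_of_mem
  obtain ⟨P, hP⟩ := Nat.exists_eq_add_of_le h1
  have h2 : deg G z ≤ ∏ y ∈ G.nbrs u \ W, deg G y :=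
    deg_le_prod_deg (x := u) (fun y hy => mem_nbrs.1 (Finset.mem_sdiff.1 hy).1)
      (by simp [hz, hzW])
  rw [hP, Nat.add_sub_cancel_left]
  nlinarith [Nat.mul_le_mul_right P (hdeg.trans h2)]

theorem Mprod_nbr (h : G.IsTransplantConfig u v v₁ v₂ W b E) : Mprod G v₁ = deg G v₂ := by
  rw [Mprod_eq_prod_nbrs, Finset.prod_eq_single v₂]
  · exact fun y hy hne => h.deg_eq_one y (mem_nbrs.1 hy) hne
  · exact fun hn => absurd (mem_nbrs.2 h.adj_next) hn

theorem Mprod_transplant_nbr (h : G.IsTransplantConfig u v v₁ v₂ W b E) :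
    Mprod (G.transplant u v W) v₁ = deg (G.transplant u v W) v₂ * (W.card + 1) := by
  classical
  have hnbrs : ∀ y, y ∈ (G.transplant u v W).nbrs v₁ ↔ G.Adj v₁ y ∧ (v₁ = u → y ∉ W) := by
    intro y
    have := h.nbr_notMem
    have := h.adj_leaf.ne'
    simp only [mem_nbrs, transplant_adj h.notMem]
    tauto
  rw [Mprod_eq_prod_nbrs, Finset.prod_eq_mul v₂ v h.next_ne, h.deg_transplant_leaf]
  · rintro y hy ⟨hy₂, hyv⟩
    have hd := h.deg_eq_one y ((hnbrs y).1 hy).1 hy₂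
    rw [deg_transplant_of_ne h.adj_of_mem h.notMem h.not_adj_of_mem ?_ hyv, hd]
    rintro rfl
    have := h.deg_eq
    have := h.one_le
    omega
  · exact fun hn => absurd ((hnbrs v₂).2 ⟨h.adj_next, fun _ => h.next_notMem⟩) hn
  · exact fun hn => absurd ((hnbrs v).2 ⟨h.adj_leaf.symm, fun _ => h.notMem⟩) hn

/-- The case where `u` is at distance at least three from the leaf `v`. -/
theorem xiAC_lt_of_far (h : G.IsTransplantConfig u v v₁ v₂ W b E) (hu₁ : u ≠ v₁) (hu₂ : u ≠ v₂)
    (hd₁ : deg G v₁ = 2) (hd₂ : deg G v₂ = 2) {z z' : V} (hz : G.Adj u z) (hzW : z ∉ W)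
    (hz₁ : z ≠ v₁) (hdz : deg G z = 2) (hz' : G.Adj z z') (hzu' : z' ≠ u)
    (hdz' : 2 ≤ deg G z') : xiAC (G.transplant u v W) < xiAC G := by
  classical
  apply xiAC_lt_of_sum_pos
  set C : ℝ := ((deg G v₁ * (∏ w ∈ W, deg G w - 1) : ℕ) : ℝ) / ((E + 1 : ℕ) : ℝ)
  set L : ℝ := ((W.card * 2 : ℕ) : ℝ) / (E : ℝ)
  set B : ℝ := (b / ((E + 1 : ℕ) : ℝ))
  have hzv : z ≠ v := by
    rintro rfl
    exact hu₁ ((h.adj_iff u).1 hz.symm)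
  have gv : -C ≤ xiACDiff G (G.transplant u v W) v := h.neg_le_diff_leaf hu₁
  have gu : C ≤ xiACDiff G (G.transplant u v W) u :=
    h.le_diff_center hu₁ hz hzW (by omega)
  have gv₁ : -L ≤ xiACDiff G (G.transplant u v W) v₁ := by
    refine neg_div_le_xiACDiff h.pos h.le_ecc_nbr (h.ecc_le_ecc _) ?_
    rw [h.Mprod_transplant_nbr, h.Mprod_nbr,
      deg_transplant_of_ne h.adj_of_mem h.notMem h.not_adj_of_mem hu₂.symm h.next_ne, hd₂]
    omega
  have gz : L ≤ xiACDiff G (G.transplant u v W) z := by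
    refine h.le_diff_of_adj hzW hz hzv hz₁ (h.ecc_le_of_two_le_deg z hdz.ge) ?_
    refine hdz'.trans (deg_le_prod_deg (x := z) (fun y hy => ?_) ?_)
    · exact mem_nbrs.1 (Finset.mem_of_mem_erase hy)
    · simp [hzu', hz']
  have hv₁v := h.adj_leaf.ne'
  have huv := h.ne
  have huW : u ∉ W := fun hm => (h.adj_of_mem u hm).ne rfl
  have gW : ∀ x ∈ W, B ≤ xiACDiff G (G.transplant u v W) x := fun x hx => h.le_diff_of_mem hx
  have hbound : ∀ x, (if x = v then -C else 0) + (if x = u then C else 0) +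
      (if x = v₁ then -L else 0) + (if x = z then L else 0) + (if x ∈ W then B else 0) ≤
      xiACDiff G (G.transplant u v W) x := by
    intro x
    by_cases hxv : x = v
    · subst hxv
      simpa [huv.symm, hv₁v.symm, hzv.symm, h.notMem] using gv
    by_cases hxu : x = u
    · subst hxu
      simpa [huv, hu₁, hz.ne, huW] using gu
    by_cases hxv₁ : x = v₁
    · subst hxv₁
      simpa [hxv, hxu, hz₁.symm, h.nbr_notMem] using gv₁
    by_cases hxz : x = z
    · subst hxz
      simpa [hxv, hxu, hxv₁, hzW] using gz
    by_cases hxW : x ∈ W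
    · simpa [hxv, hxu, hxv₁, hxz, hxW] using gW x hxW
    · simpa [hxv, hxu, hxv₁, hxz, hxW] using h.diff_nonneg hxu hxv hxv₁
  refine lt_of_lt_of_le ?_ (Finset.sum_le_sum fun x _ => hbound x)
  have hB : 0 < B := div_pos (by exact_mod_cast h.one_le) (by positivity)
  have hk : (0 : ℝ) < W.card := by exact_mod_cast h.one_le_card
  simp only [Finset.sum_add_distrib, Finset.sum_ite_eq', Finset.mem_univ, if_true,
    Finset.sum_ite_mem, Finset.univ_inter, Finset.sum_const, nsmul_eq_mul]
  nlinarith [mul_pos hk hB]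

/-- The case where `u` is at distance two from the leaf `v`. -/
theorem xiAC_lt_of_eq_next (h : G.IsTransplantConfig u v v₁ u W b E) (hE : 2 ≤ E) :
    xiAC (G.transplant u v W) < xiAC G := by
  classical
  apply xiAC_lt_of_sum_pos
  have hu₁ : u ≠ v₁ := h.adj_next.ne'
  set C : ℝ := ((deg G v₁ * (∏ w ∈ W, deg G w - 1) : ℕ) : ℝ) / ((E + 1 : ℕ) : ℝ)
  set L : ℝ := ((W.card * b : ℕ) : ℝ) / (E : ℝ) with hL
  set B : ℝ := (b / ((E + 1 : ℕ) : ℝ)) with hB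
  set A : ℝ := ((W.card * 1 : ℕ) : ℝ) / ((E + 1 : ℕ) : ℝ) with hA
  set S : Finset V := (G.nbrs u \ W).erase v₁ with hS
  have gv : -C ≤ xiACDiff G (G.transplant u v W) v := h.neg_le_diff_leaf hu₁
  have gu : C ≤ xiACDiff G (G.transplant u v W) u :=
    h.le_diff_center hu₁ h.adj_next.symm h.nbr_notMem le_rfl
  have gv₁ : -L ≤ xiACDiff G (G.transplant u v W) v₁ := by
    refine neg_div_le_xiACDiff h.pos h.le_ecc_nbr (h.ecc_le_ecc _) ?_
    rw [h.Mprod_transplant_nbr, h.Mprod_nbr, h.deg_transplant, h.deg_eq]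
    linarith
  have hv₁v := h.adj_leaf.ne'
  have huv := h.ne
  have huW : u ∉ W := h.next_notMem
  have hSmem : ∀ x, x ∈ S ↔ x ≠ v₁ ∧ G.Adj u x ∧ x ∉ W := by
    intro x
    simp [hS]
  have hvS : v ∉ S := by
    intro hm
    exact hu₁ ((h.adj_iff u).1 ((hSmem v).1 hm).2.1.symm)
  have huS : u ∉ S := fun hm => ((hSmem u).1 hm).2.1.ne rfl
  have hv₁S : v₁ ∉ S := fun hm => ((hSmem v₁).1 hm).1 rfl
  have gS : ∀ x ∈ S, x ≠ v → A ≤ xiACDiff G (G.transplant u v W) x := by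
    intro x hx hxv
    obtain ⟨hxv₁, hux, hxW⟩ := (hSmem x).1 hx
    exact h.le_diff_of_adj hxW hux hxv hxv₁ (h.ecc_le x)
      (one_le_prod_deg (x := x) fun y hy => mem_nbrs.1 (Finset.mem_of_mem_erase hy))
  have gW : ∀ x ∈ W, B ≤ xiACDiff G (G.transplant u v W) x := fun x hx => h.le_diff_of_mem hx
  have hbound : ∀ x, (if x = v then -C else 0) + (if x = u then C else 0) +
      (if x = v₁ then -L else 0) + (if x ∈ S then A else 0) + (if x ∈ W then B else 0) ≤
      xiACDiff G (G.transplant u v W) x := by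
    intro x
    by_cases hxv : x = v
    · subst hxv
      simpa [huv.symm, hv₁v.symm, hvS, h.notMem] using gv
    by_cases hxu : x = u
    · subst hxu
      simpa [huv, hu₁, huS, huW] using gu
    by_cases hxv₁ : x = v₁
    · subst hxv₁
      simpa [hxv, hxu, hv₁S, h.nbr_notMem] using gv₁
    by_cases hxS : x ∈ S
    · have hxW := ((hSmem x).1 hxS).2.2
      simpa [hxv, hxu, hxv₁, hxS, hxW] using gS x hxS hxv
    by_cases hxW : x ∈ W
    · simpa [hxv, hxu, hxv₁, hxS, hxW] using gW x hxW
    · simpa [hxv, hxu, hxv₁, hxS, hxW] using h.diff_nonneg hxu hxv hxv₁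
  refine lt_of_lt_of_le ?_ (Finset.sum_le_sum fun x _ => hbound x)
  have hScard : S.card = b := by
    have hsub : W ⊆ G.nbrs u := fun w hw => mem_nbrs.2 (h.adj_of_mem w hw)
    have h1 := Finset.card_sdiff_add_card_eq_card hsub
    have h2 := Finset.card_erase_add_one (s := G.nbrs u \ W) (a := v₁)
      (by simp [h.adj_next.symm, h.nbr_notMem])
    have h3 := h.deg_eq
    rw [deg_eq_card_nbrs] at h3
    rw [← hS] at h2
    omega
  have hk : (0 : ℝ) < W.card := by exact_mod_cast h.one_le_card
  have hb : (0 : ℝ) < b := by exact_mod_cast h.one_le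
  have hE' : (2 : ℝ) ≤ E := by exact_mod_cast hE
  simp only [Finset.sum_add_distrib, Finset.sum_ite_eq', Finset.mem_univ, if_true,
    Finset.sum_ite_mem, Finset.univ_inter, Finset.sum_const, nsmul_eq_mul, hScard]
  have hcalc : -C + C + -L + b * A + W.card * B = W.card * b * (2 / (E + 1) - 1 / E) := by
    rw [hL, hA, hB]
    push_cast
    ring
  rw [hcalc]
  have : (0 : ℝ) < 2 / (E + 1) - 1 / E := by
    rw [sub_pos, div_lt_div_iff₀ (by linarith) (by linarith)]
    linarith
  positivity

/-- The case where `u` is the neighbor of the leaf `v`. -/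
theorem xiAC_lt_of_eq_nbr (h : G.IsTransplantConfig u v u v₂ W b E)
    (hE : E = 1 ∧ deg G v₂ = 1 ∨ deg G v₂ = 2 ∧ ∃ z, G.Adj v₂ z ∧ z ≠ u ∧ 2 ≤ deg G z) :
    xiAC (G.transplant u v W) < xiAC G := by
  classical
  apply xiAC_lt_of_sum_pos
  have huv := h.ne
  have huW : u ∉ W := h.nbr_notMem
  set L : ℝ := ((deg G v₂ * W.card : ℕ) : ℝ) / (E : ℝ) with hL
  set B : ℝ := (b / ((E + 1 : ℕ) : ℝ)) with hB
  set A : ℝ := ((W.card : ℕ) : ℝ) / ((E + 1 : ℕ) : ℝ) with hA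
  have gu : -L ≤ xiACDiff G (G.transplant u v W) u := by
    refine neg_div_le_xiACDiff h.pos h.le_ecc_nbr (h.ecc_le_ecc _) ?_
    rw [h.Mprod_transplant_nbr, h.Mprod_nbr, deg_transplant_of_ne h.adj_of_mem h.notMem
      h.not_adj_of_mem h.adj_next.ne' h.next_ne]
    linarith
  have gv : A ≤ xiACDiff G (G.transplant u v W) v := by
    refine div_le_xiACDiff (h.ecc_pos v) (h.ecc_le v) (h.ecc_le_ecc v) ?_
    rw [h.Mprod_transplant_leaf, h.Mprod_leaf, h.deg_transplant, h.deg_eq, Finset.prod_eq_one]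
    · omega
    · intro w hw
      refine h.deg_eq_one w (h.adj_of_mem w hw) ?_
      rintro rfl
      exact h.next_notMem hw
  obtain ⟨t, ht, hLt⟩ : ∃ t, t ≤ xiACDiff G (G.transplant u v W) v₂ ∧ L ≤ A + t := by
    have hgain := fun m F => h.le_diff_of_adj (m := m) (F := F) h.next_notMem h.adj_next
      h.next_ne h.adj_next.ne'
    rcases hE with ⟨rfl, hd⟩ | ⟨hd, z, hz, hzu, hdz⟩
    · refine ⟨_, hgain 1 2 (h.ecc_le v₂) (one_le_prod_deg (x := v₂) fun y hy =>
        mem_nbrs.1 (Finset.mem_of_mem_erase hy)), ?_⟩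
      rw [hL, hA, hd]
      push_cast
      linarith
    · refine ⟨_, hgain 2 E (h.ecc_le_of_two_le_deg v₂ hd.ge) (hdz.trans (deg_le_prod_deg
        (x := v₂) (fun y hy => mem_nbrs.1 (Finset.mem_of_mem_erase hy)) (by simp [hz, hzu]))), ?_⟩
      have : 0 ≤ A := by positivity
      rw [hL, hd, mul_comm]
      linarith
  have gW : ∀ x ∈ W, B ≤ xiACDiff G (G.transplant u v W) x := fun x hx => h.le_diff_of_mem hx
  have hbound : ∀ x, (if x = v then A else 0) + (if x = u then -L else 0) +
      (if x = v₂ then t else 0) + (if x ∈ W then B else 0) ≤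
      xiACDiff G (G.transplant u v W) x := by
    intro x
    by_cases hxv : x = v
    · subst hxv
      simpa [huv.symm, h.next_ne.symm, h.notMem] using gv
    by_cases hxu : x = u
    · subst hxu
      simpa [huv, h.adj_next.ne, huW] using gu
    by_cases hxv₂ : x = v₂
    · subst hxv₂
      simpa [hxv, hxu, h.next_notMem] using ht
    by_cases hxW : x ∈ W
    · simpa [hxv, hxu, hxv₂, hxW] using gW x hxW
    · simpa [hxv, hxu, hxv₂, hxW] using h.diff_nonneg hxu hxv hxu
  refine lt_of_lt_of_le ?_ (Finset.sum_le_sum fun x _ => hbound x)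
  have hB : 0 < B := div_pos (by exact_mod_cast h.one_le) (by positivity)
  have hk : (0 : ℝ) < W.card := by exact_mod_cast h.one_le_card
  simp only [Finset.sum_add_distrib, Finset.sum_ite_eq', Finset.mem_univ, if_true,
    Finset.sum_ite_mem, Finset.univ_inter, Finset.sum_const, nsmul_eq_mul]
  nlinarith [mul_pos hk hB]

end IsTransplantConfig

theorem two_le_deg_of_adj {x y z : V} (hy : G.Adj x y) (hz : G.Adj x z) (hne : y ≠ z) :
    2 ≤ deg G x := by
  rw [deg_eq_card_nbrs]
  exact Finset.one_lt_card.2 ⟨y, mem_nbrs.2 hy, z, mem_nbrs.2 hz, hne⟩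

theorem IsTree.dist_add_one_le_of_two_le_deg (hG : G.IsTree) {x : V} (hx : 2 ≤ deg G x) {D : ℕ}
    (hD : ∀ a b, G.dist a b ≤ D) (y : V) : G.dist x y + 1 ≤ D := by
  rw [deg_eq_card_nbrs] at hx
  obtain ⟨a, ha, b, hb, hab⟩ := Finset.one_lt_card.1 hx
  rw [mem_nbrs] at ha hb
  have h1 := hD y a
  have h2 := hD y b
  rw [dist_comm]
  rcases hG.dist_eq_dist_add_one_of_adj y ha with h | h
  · rcases hG.dist_eq_dist_add_one_of_adj y hb with h' | h'
    · exact absurd (hG.eq_of_adj_of_dist_add_one_eq ha hb h.symm h'.symm) hab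
    · omega
  · omega

theorem IsTree.two_le_deg_getVert (hG : G.IsTree) {v z : V} {p : G.Walk v z} (hp : p.IsPath)
    {j : ℕ} (hj : 1 ≤ j) (hjp : j < p.length) : 2 ≤ deg G (p.getVert j) := by
  obtain ⟨j, rfl⟩ := Nat.exists_eq_add_of_le' hj
  refine two_le_deg_of_adj (p.adj_getVert_succ (i := j) (by omega)).symm
    (p.adj_getVert_succ hjp) fun h => ?_
  have h1 := hG.dist_start_getVert hp (j := j) (by omega)
  have h2 := hG.dist_start_getVert hp (j := j + 1 + 1) (by omega)
  rw [h] at h1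
  omega

theorem IsTree.isTransplantConfig (hG : G.IsTree) {v z : V} {p : G.Walk v z} (hp : p.IsPath)
    (hmax : ∀ x y, G.dist x y ≤ p.length) {m : ℕ} (hm : 1 ≤ m) (hmp : m < p.length)
    {W : Finset V} (hW : ∀ w ∈ W, G.Adj (p.getVert m) w) (hWp : ∀ w ∈ W, w ∉ p.support) {b : ℕ}
    (hdeg : deg G (p.getVert m) = W.card + 1 + b) (hb : 1 ≤ b) (hcard : 1 ≤ W.card) :
    G.IsTransplantConfig (p.getVert m) v (p.getVert 1) (p.getVert 2) W b (p.length - 1) := by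
  have hvz := hG.dist_eq_length_of_isPath hp
  have hadj₀ : G.Adj v (p.getVert 1) := by
    simpa using p.adj_getVert_succ (i := 0) (by omega)
  have hadj₁ : G.Adj (p.getVert 1) (p.getVert 2) := p.adj_getVert_succ (i := 1) (by omega)
  have hz₁ := hG.dist_end_getVert hp (j := 1)
  have hz₂ := hG.dist_end_getVert hp (j := 2)
  have hvadj : ∀ y, G.Adj v y ↔ y = p.getVert 1 := by
    refine fun y => ⟨fun hy => ?_, fun hy => hy ▸ hadj₀⟩
    have h1 := hmax z y
    have h2 := hG.dist_eq_dist_add_one_of_adj z hy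
    rw [dist_comm] at hvz
    exact hG.eq_of_adj_of_dist_add_one_eq (z := z) hy hadj₀ (by omega) (by omega)
  have hvB : v ∉ G.branchSet (p.getVert m) W := by
    rintro ⟨w, hw, h⟩
    have hprev : G.Adj (p.getVert m) (p.getVert (m - 1)) := by
      have := p.adj_getVert_succ (i := m - 1) (by omega)
      rwa [Nat.sub_add_cancel hm, adj_comm] at this
    have h1 := hG.dist_start_getVert hp hmp.le
    have h2 := hG.dist_start_getVert hp (j := m - 1) (by omega)
    rw [dist_comm (v := v), dist_comm (v := v)] at h
    have := hG.eq_of_adj_of_dist_add_one_eq (z := v) (hW w hw) hprev h.symm (by omega)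
    exact hWp w hw (this ▸ p.getVert_mem_support _)
  have hzB : z ∉ G.branchSet (p.getVert m) W := by
    rintro ⟨w, hw, h⟩
    have h1 := hG.dist_end_getVert hp (j := m)
    have h2 := hG.dist_end_getVert hp (j := m + 1)
    rw [dist_comm (v := z), dist_comm (v := z)] at h
    have := hG.eq_of_adj_of_dist_add_one_eq (z := z) (hW w hw) (p.adj_getVert_succ hmp) h.symm
      (by omega)
    exact hWp w hw (this ▸ p.getVert_mem_support _)
  have h_inner : ∀ x, 2 ≤ deg G x → ecc G x ≤ p.length - 1 := by
    refine fun x hx => ecc_le fun y => ?_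
    have := hG.dist_add_one_le_of_two_le_deg hx hmax y
    omega
  have hlen : p.length - 1 + 1 = p.length := by omega
  refine
    { adj_of_mem := hW
      notMem := fun h => hWp v h p.start_mem_support
      ne := by simpa using hG.getVert_ne_getVert hp hmp.le (Nat.zero_le _) (by omega)
      not_adj_of_mem := ?_
      deg_eq := hdeg
      one_le := hb
      one_le_card := hcard
      ecc_le_ecc := hG.ecc_le_ecc_transplant hW hvB hzB (hvz ▸ hmax) ?_
      ecc_pos := ?_
      ecc_le := fun x => by simpa [hlen] using ecc_le (hmax x)
      ecc_le_of_two_le_deg := h_inner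
      le_ecc_leaf := by
        rw [hlen, ← hvz]
        exact dist_le_ecc v z
      le_ecc_nbr := by
        rw [← hz₁, dist_comm]
        exact dist_le_ecc _ z
      pos := by omega
      adj_iff := hvadj
      adj_next := hadj₁
      next_ne := by
        simpa using hG.getVert_ne_getVert hp (j := 2) (l := 0) (by omega) (by omega) (by omega)
      deg_eq_one := ?_
      next_notMem := fun h => hWp _ h (p.getVert_mem_support _) }
  · intro w hw hvw
    exact hWp w hw ((hvadj w).1 hvw ▸ p.getVert_mem_support _)
  · have h1 := hG.dist_start_getVert hp hmp.le
    have h2 := hG.dist_end_getVert hp (j := m)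
    rw [dist_comm (u := p.getVert m)]
    omega
  · intro x
    have h1 := dist_le_ecc (G := G) x v
    have h2 := dist_le_ecc (G := G) x z
    have h3 : G.dist v z ≤ G.dist v x + G.dist x z := hG.connected.dist_triangle
    rw [dist_comm (u := v) (v := x)] at h3
    omega
  · intro y hy hy₂
    have h1 := one_le_deg_of_adj hy.symm
    by_contra hne
    have h2 := hG.dist_add_one_le_of_two_le_deg (x := y) (by omega) hmax z
    rw [dist_comm] at h2
    have h3 := hG.dist_eq_dist_add_one_of_adj z hy
    exact hy₂ (hG.eq_of_adj_of_dist_add_one_eq (z := z) hy hadj₁ (by omega) (by omega))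

end Fintype

end SimpleGraph

/-- Theorem: Let `T ≠ P_n` be a tree on `n` vertices and `P = v₀v₁…v_D` a diametric path
chosen so that the first branching vertex is as far as possible from `v₀`; let `vᵢ` be that
first branching vertex. If `D > 2`, `i = 1` and `deg(v_{i+1}) > 2` put `u = v_{i+1}`,
otherwise `u = vᵢ`. For neighbors `w₁, …, w_k` of `u` outside of `P` (`1 ≤ k ≤ deg(u) - 2`),
the tree `T'` obtained by deleting the edges `u wⱼ` and adding the edges `v₀ wⱼ` satisfies
`ξ^{ac}(T) > ξ^{ac}(T')`. -/
theorem xiAC_path_transformation (n : ℕ) {V : Type*} [Fintype V] (T : SimpleGraph V)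
    (hT : T.IsTree) (hn : Fintype.card V = n)
    (hnotpath : ¬ Nonempty (T ≃g pathGraph n))
    (D : ℕ) (hD : D = gdiam T)
    (v0 vD : V) (p : T.Walk v0 vD) (hp : p.IsPath) (hlen : p.length = D)
    (i : ℕ) (hiD : i ≤ D)
    (hbranch : 3 ≤ deg T (p.getVert i))
    (hfirst : ∀ j < i, deg T (p.getVert j) < 3)
    (hfurthest : ∀ (a b : V) (q : T.Walk a b), q.IsPath → q.length = D →
      ∀ j ≤ D, 3 ≤ deg T (q.getVert j) → (∀ j' < j, deg T (q.getVert j') < 3) → j ≤ i)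
    (u : V)
    (hu1 : 2 < D ∧ i = 1 ∧ 2 < deg T (p.getVert (i + 1)) → u = p.getVert (i + 1))
    (hu2 : ¬ (2 < D ∧ i = 1 ∧ 2 < deg T (p.getVert (i + 1))) → u = p.getVert i)
    (k : ℕ) (hk1 : 1 ≤ k) (hk2 : k + 2 ≤ deg T u)
    (w : Fin k → V) (hwinj : Function.Injective w)
    (hwadj : ∀ j, T.Adj u (w j)) (hwout : ∀ j, w j ∉ p.support)
    (T' : SimpleGraph V)
    (hT' : T' = fromEdgeSet
      ((T.edgeSet \ {e | ∃ j, e = s(u, w j)}) ∪ {e | ∃ j, e = s(v0, w j)})) :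
    xiAC T' < xiAC T := by
  classical
  have hmax : ∀ x y, T.dist x y ≤ p.length := fun x y => by
    rw [hlen, hD]
    exact dist_le_gdiam x y
  have hvD := hT.dist_eq_length_of_isPath hp
  have hdeg_v0 : ¬ 2 ≤ deg T v0 := fun h => by
    have := hT.dist_add_one_le_of_two_le_deg h hmax vD
    omega
  have hdeg_vD : ¬ 2 ≤ deg T vD := fun h => by
    have := hT.dist_add_one_le_of_two_le_deg h hmax v0
    rw [dist_comm] at this
    omega
  have hi0 : i ≠ 0 := by
    rintro rfl
    rw [Walk.getVert_zero] at hbranch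
    omega
  have hiD' : i ≠ D := by
    rintro rfl
    rw [← hlen, Walk.getVert_length] at hbranch
    omega
  set W : Finset V := Finset.univ.image w with hWdef
  have hWcard : W.card = k := by
    rw [hWdef, Finset.card_image_of_injective _ hwinj, Finset.card_univ, Fintype.card_fin]
  have hTW : T' = T.transplant u v0 W := by
    rw [hT', transplant]
    simp [hWdef]
  have hWadj : ∀ x ∈ W, T.Adj u x := by
    simpa [hWdef] using hwadj
  have hWout : ∀ x ∈ W, x ∉ p.support := by
    simpa [hWdef] using hwout
  obtain ⟨b, hb⟩ := Nat.exists_eq_add_of_le hk2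
  rw [hTW]
  have hshape : ∀ m, 1 ≤ m → m < D → u = p.getVert m →
      T.IsTransplantConfig u v0 (p.getVert 1) (p.getVert 2) W (1 + b) (p.length - 1) := by
    rintro m hm hmD rfl
    exact hT.isTransplantConfig hp hmax hm (hlen ▸ hmD) hWadj hWout (by omega) (by omega)
      (by omega)
  have hdeg2 : ∀ j, 1 ≤ j → j < D → 2 ≤ deg T (p.getVert j) := fun j hj hjD =>
    hT.two_le_deg_getVert hp hj (hlen ▸ hjD)
  have h_near : u = p.getVert 2 → 2 < D → xiAC (T.transplant u v0 W) < xiAC T := by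
    intro hu h2D
    have h := hshape 2 (by omega) h2D hu
    rw [← hu] at h
    exact h.xiAC_lt_of_eq_next (by omega)
  by_cases hcase : 2 < D ∧ i = 1 ∧ 2 < deg T (p.getVert (i + 1))
  · have hu := hu1 hcase
    obtain ⟨h2D, rfl, -⟩ := hcase
    exact h_near hu h2D
  have hu := hu2 hcase
  obtain hi | hi | hi : i = 1 ∨ i = 2 ∨ 3 ≤ i := by omega
  · subst hi
    have h := hshape 1 le_rfl (by omega) hu
    rw [← hu] at h
    refine h.xiAC_lt_of_eq_nbr ?_
    by_cases h2D : D = 2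
    · left
      have hend : p.getVert 2 = vD := by
        rw [← h2D, ← hlen, Walk.getVert_length]
      have := one_le_deg_of_adj h.adj_next.symm
      rw [hend] at this ⊢
      omega
    · right
      have hd₂ := hdeg2 2 (by omega) (by omega)
      have hd₂' : deg T (p.getVert 2) = 2 := by
        have : ¬ 2 < deg T (p.getVert 2) := fun h' => hcase ⟨by omega, rfl, h'⟩
        omega
      have h3D : D ≠ 3 := by
        intro h3D
        have := hfurthest vD v0 p.reverse hp.reverse (by simpa using hlen) 2 (by omega)
        simp only [Walk.getVert_reverse, hlen, h3D] at this
        refine absurd (this hbranch fun j hj => ?_) (by omega)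
        interval_cases j
        · rw [← h3D, Nat.sub_zero, ← hlen, Walk.getVert_length]
          omega
        · change deg T (p.getVert 2) < 3
          omega
      refine ⟨hd₂', p.getVert 3, p.adj_getVert_succ (by omega), ?_,
        hdeg2 3 (by omega) (by omega)⟩
      rw [hu]
      exact hT.getVert_ne_getVert hp (by omega) (by omega) (by omega)
  · subst hi
    exact h_near hu (by omega)
  · have hd : ∀ j, 1 ≤ j → j < i → deg T (p.getVert j) = 2 := fun j hj hji => by
      have h1 := hdeg2 j hj (by omega)
      have h2 := hfirst j hji
      omega
    have hne : ∀ {j l : ℕ}, j ≤ i → l ≤ i → j ≠ l → p.getVert j ≠ p.getVert l := fun hj hl =>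
      hT.getVert_ne_getVert hp (by omega) (by omega)
    have hprev : ∀ j, j < i → T.Adj (p.getVert (j + 1)) (p.getVert j) := fun j hj =>
      (p.adj_getVert_succ (by omega)).symm
    obtain ⟨l, rfl⟩ := Nat.exists_eq_add_of_le' hi
    have h := hshape (l + 3) (by omega) (by omega) hu
    refine h.xiAC_lt_of_far (z := p.getVert (l + 2)) (z' := p.getVert (l + 1))
      (hu ▸ hne ?_ ?_ ?_) (hu ▸ hne ?_ ?_ ?_) (hd 1 ?_ ?_) (hd 2 ?_ ?_) (hu ▸ hprev (l + 2) ?_)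
      (fun hm => hWout _ hm (p.getVert_mem_support _)) (hne ?_ ?_ ?_) (hd _ ?_ ?_)
      (hprev (l + 1) ?_) (hu ▸ hne ?_ ?_ ?_) (hd (l + 1) ?_ ?_).ge <;> omega
end
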